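/- arXiv:math/0202265 — 6 statements merged into one kernel-verified Lean document; each statement's English description precedes it below -/
import Mathlib

section
/- Let H be a separable, infinite-dimensional complex Hilbert space and let S be a countable subset of H. Then the set of operators A in the positive part of the closed unit ball of B(H) with the property that every nonzero vector in the linear span of S is cyclic for A is comeager in the positive part of the closed unit ball of B(H) equipped with the relative strong operator topology. -/
open scoped InnerProductSpace ComplexOrder

noncomputable section

/-- The positive part of the closed unit ball of `B(H)`: self-adjoint operators `A` with
`0 ≤ ⟪A v, v⟫ ≤ ‖v‖²` for all `v`. -/
def posUnitBall (H : Type*) [NormedAddCommGroup H] [InnerProductSpace ℂ H]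
    [CompleteSpace H] :
    Set (H →L[ℂ] H) :=
  {A | IsSelfAdjoint A ∧ ∀ v : H, 0 ≤ ⟪A v, v⟫_ℂ ∧ ⟪A v, v⟫_ℂ ≤ ((‖v‖ ^ 2 : ℝ) : ℂ)}

/-- The relative strong operator topology on the positive part of the unit ball:
the topology of pointwise convergence on `H`. -/
def sot (H : Type*) [NormedAddCommGroup H] [InnerProductSpace ℂ H] [CompleteSpace H] :
    TopologicalSpace (posUnitBall H) :=
  TopologicalSpace.induced (fun A : posUnitBall H => ((A : H →L[ℂ] H) : H → H))
    Pi.topologicalSpace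

section Model

variable {H : Type*} [NormedAddCommGroup H] [InnerProductSpace ℂ H]

/-- A separable infinite-dimensional Hilbert space has a Hilbert basis indexed by `ℕ`. -/
lemma exists_hilbertBasis_nat [CompleteSpace H] [TopologicalSpace.SeparableSpace H]
    (hinf : ¬ FiniteDimensional ℂ H) : Nonempty (HilbertBasis ℕ ℂ H) := by
  obtain ⟨w, b, hb⟩ := exists_hilbertBasis ℂ H
  have hcount : Countable w := by
    have ho : Orthonormal ℂ (fun i : w => (i : H)) := hb ▸ b.orthonormal
    have : DiscreteTopology w := by
      refine DiscreteTopology.of_forall_le_dist one_pos fun i j hij => ?_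
      have h1 : ‖(i : H) - j‖ ^ 2 = 2 := by
        rw [@norm_sub_sq ℂ, ho.1 i, ho.1 j, ho.2 hij]
        norm_num
      change 1 ≤ dist i j
      rw [Subtype.dist_eq, dist_eq_norm]
      nlinarith [norm_nonneg ((i : H) - j)]
    exact TopologicalSpace.separableSpace_iff_countable.mp inferInstance
  have hinfw : Infinite w := by
    by_contra hfin
    rw [not_infinite_iff_finite] at hfin
    have := Fintype.ofFinite w
    exact hinf (Module.Basis.finiteDimensional_of_finite b.toOrthonormalBasis.toBasis)
  obtain ⟨f⟩ := nonempty_equiv_of_countable (α := ℕ) (β := w)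
  refine ⟨HilbertBasis.mk (v := b ∘ f) (b.orthonormal.comp f f.injective) ?_⟩
  rw [f.surjective.range_comp, b.dense_span]

/-- The unilateral shift along a Hilbert basis. -/
lemma HilbertBasis.exists_shift [CompleteSpace H] (e : HilbertBasis ℕ ℂ H) :
    ∃ S : H →L[ℂ] H, (ContinuousLinearMap.adjoint S) ∘L S = 1 ∧ ∀ n, S (e n) = e (n + 1) := by
  have ho : Orthonormal ℂ (fun n => e (n + 1)) := e.orthonormal.comp _ (add_left_injective 1)
  let L : H →ₗᵢ[ℂ] H := ho.orthogonalFamily.linearIsometry.comp e.repr.toLinearIsometry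
  refine ⟨L.toContinuousLinearMap, ?_, fun n => ?_⟩
  · exact ContinuousLinearMap.norm_map_iff_adjoint_comp_self _ |>.mp L.norm_map
  · simp [L, e.repr_self, OrthogonalFamily.linearIsometry_apply_single]

lemma mem_posUnitBall_iff [CompleteSpace H] {A : H →L[ℂ] H} :
    A ∈ posUnitBall H ↔ A.IsPositive ∧ (1 - A).IsPositive := by
  have key : ∀ v : H, ⟪v, v⟫_ℂ = ((‖v‖ ^ 2 : ℝ) : ℂ) := fun v => by
    rw [inner_self_eq_norm_sq_to_K]; push_cast; rfl
  constructor
  · rintro ⟨h1, h2⟩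
    refine ⟨(ContinuousLinearMap.isPositive_iff' _).mpr ⟨h1, fun v => (h2 v).1⟩,
      (ContinuousLinearMap.isPositive_iff' _).mpr ⟨(IsSelfAdjoint.one _).sub h1, fun v => ?_⟩⟩
    have := (h2 v).2
    simpa [inner_sub_left, key] using this
  · rintro ⟨h1, h2⟩
    refine ⟨h1.isSelfAdjoint, fun v => ⟨h1.inner_nonneg_left v, ?_⟩⟩
    have := h2.inner_nonneg_left v
    simpa [inner_sub_left, key] using this

/-- The free Jacobi operator associated with a Hilbert basis, scaled to have spectrum `[0, 1]`. -/
lemma HilbertBasis.exists_jacobi [CompleteSpace H] (e : HilbertBasis ℕ ℂ H) :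
    ∃ D ∈ posUnitBall H, (4 : ℂ) • D (e 0) = (2 : ℂ) • e 0 + e 1 ∧
      ∀ n, (4 : ℂ) • D (e (n + 1)) = e n + (2 : ℂ) • e (n + 1) + e (n + 2) := by
  obtain ⟨S, hS, hSe⟩ := e.exists_shift
  have hSadj : ∀ v, ContinuousLinearMap.adjoint S (S v) = v := fun v => by
    simpa using congrArg (fun T : H →L[ℂ] H => T v) hS
  have h0 : ContinuousLinearMap.adjoint S (e 0) = 0 := by
    apply e.repr.injective
    ext i
    rw [e.repr_apply_apply, ContinuousLinearMap.adjoint_inner_right, hSe]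
    simp [orthonormal_iff_ite.mp e.orthonormal]
  have hpos : ∀ T : H →L[ℂ] H,
      ((4⁻¹ : ℂ) • ((ContinuousLinearMap.adjoint T) ∘L T)).IsPositive := fun T =>
    (ContinuousLinearMap.isPositive_adjoint_comp_self T).smul_of_nonneg
      (by simp)
  have hD : ∀ v, (4 : ℂ) • ((4⁻¹ : ℂ) • ((ContinuousLinearMap.adjoint (1 + S)) ∘L (1 + S))) v
      = (2 : ℂ) • v + S v + ContinuousLinearMap.adjoint S v := fun v => by
    simp [map_add, hSadj, ContinuousLinearMap.one_def, ContinuousLinearMap.adjoint_id]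
    module
  refine ⟨(4⁻¹ : ℂ) • ((ContinuousLinearMap.adjoint (1 + S)) ∘L (1 + S)),
    mem_posUnitBall_iff.mpr ⟨hpos _, ?_⟩, ?_, fun n => ?_⟩
  · convert hpos (1 - S) using 1
    ext v
    simp [map_add, map_sub, hSadj, ContinuousLinearMap.one_def, ContinuousLinearMap.adjoint_id]
    module
  · rw [hD, hSe, h0]; simp
  · rw [hD, hSe, ← hSe n, hSadj, hSe]; module

/-- An operator acting as a free Jacobi matrix has no eigenvalues. -/
lemma HilbertBasis.jacobi_injective [CompleteSpace H] (e : HilbertBasis ℕ ℂ H) {D : H →L[ℂ] H}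
    (hsa : IsSelfAdjoint D) (h0 : (4 : ℂ) • D (e 0) = (2 : ℂ) • e 0 + e 1)
    (hsucc : ∀ n, (4 : ℂ) • D (e (n + 1)) = e n + (2 : ℂ) • e (n + 1) + e (n + 2))
    {μ : ℂ} {y : H} (hy : D y = μ • y) : y = 0 := by
  have hsym : ∀ u, 4 * μ * ⟪u, y⟫_ℂ = ⟪(4 : ℂ) • D u, y⟫_ℂ := fun u => by
    have : ⟪D u, y⟫_ℂ = ⟪u, D y⟫_ℂ := hsa.isSymmetric u y
    rw [inner_smul_left, this, hy, inner_smul_right]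
    rw [map_ofNat, mul_assoc]
  have r0 : ⟪e 1, y⟫_ℂ = (4 * μ - 2) * ⟪e 0, y⟫_ℂ := by
    have := hsym (e 0)
    rw [h0, inner_add_left, inner_smul_left] at this
    rw [Complex.conj_ofNat] at this
    linear_combination -this
  have rs : ∀ n, ⟪e (n + 2), y⟫_ℂ = (4 * μ - 2) * ⟪e (n + 1), y⟫_ℂ - ⟪e n, y⟫_ℂ := fun n => by
    have := hsym (e (n + 1))
    rw [hsucc, inner_add_left, inner_add_left, inner_smul_left] at this
    rw [Complex.conj_ofNat] at this
    linear_combination -this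
  have hinv : ∀ n, ⟪e (n + 1), y⟫_ℂ ^ 2 - (4 * μ - 2) * ⟪e n, y⟫_ℂ * ⟪e (n + 1), y⟫_ℂ
      + ⟪e n, y⟫_ℂ ^ 2 = ⟪e 0, y⟫_ℂ ^ 2 := by
    intro n
    induction n with
    | zero => rw [zero_add, r0]; ring
    | succ n ih => rw [← ih, rs n]; ring
  have hlim : Filter.Tendsto (fun n => ⟪e n, y⟫_ℂ) Filter.atTop (nhds 0) := by
    have h1 := (e.orthonormal.inner_products_summable y).tendsto_atTop_zero
    rw [tendsto_zero_iff_norm_tendsto_zero]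
    have h2 := h1.sqrt
    simpa using h2
  have hlim' := hlim.comp (Filter.tendsto_add_atTop_nat 1)
  have hz : ⟪e 0, y⟫_ℂ ^ 2 = 0 := by
    have h1 := ((hlim'.pow 2).sub ((hlim.const_mul (4 * μ - 2)).mul hlim')).add (hlim.pow 2)
    have h2 := h1.congr hinv
    simpa using tendsto_nhds_unique tendsto_const_nhds h2
  have hz0 : ⟪e 0, y⟫_ℂ = 0 := by simpa using hz
  have hall : ∀ n, ⟪e n, y⟫_ℂ = 0 ∧ ⟪e (n + 1), y⟫_ℂ = 0 := by
    intro n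
    induction n with
    | zero => exact ⟨hz0, by rw [zero_add, r0, hz0, mul_zero]⟩
    | succ n ih => exact ⟨ih.2, by rw [rs, ih.1, ih.2]; simp⟩
  apply e.repr.injective
  ext i
  rw [e.repr_apply_apply, (hall i).1]
  simp

/-- Every basis vector is a polynomial in the free Jacobi operator applied to the first one. -/
lemma jacobi_basis_mem {e : ℕ → H} {D : H →L[ℂ] H}
    (h0 : (4 : ℂ) • D (e 0) = (2 : ℂ) • e 0 + e 1)
    (hsucc : ∀ n, (4 : ℂ) • D (e (n + 1)) = e n + (2 : ℂ) • e (n + 1) + e (n + 2)) (n : ℕ) :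
    ∃ p : Polynomial ℂ, e n = Polynomial.aeval D p (e 0) := by
  suffices h : (∃ p : Polynomial ℂ, e n = Polynomial.aeval D p (e 0)) ∧
      ∃ p : Polynomial ℂ, e (n + 1) = Polynomial.aeval D p (e 0) from h.1
  induction n with
  | zero =>
    refine ⟨⟨1, by simp⟩, ⟨Polynomial.C 4 * Polynomial.X - Polynomial.C 2, ?_⟩⟩
    have h4 : Polynomial.aeval D (Polynomial.C 4 * Polynomial.X - Polynomial.C 2 : Polynomial ℂ) (e 0)
      = (4 : ℂ) • D (e 0) - (2 : ℂ) • e 0 := by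
      simp [Algebra.algebraMap_eq_smul_one]
    rw [h4, h0]; simp
  | succ n ih =>
    obtain ⟨⟨p, hp⟩, ⟨q, hq⟩⟩ := ih
    refine ⟨⟨q, hq⟩, ⟨(Polynomial.C 4 * Polynomial.X - Polynomial.C 2) * q - p, ?_⟩⟩
    have h4 : Polynomial.aeval D ((Polynomial.C 4 * Polynomial.X - Polynomial.C 2) * q - p : Polynomial ℂ) (e 0)
      = (4 : ℂ) • D (e (n + 1)) - (2 : ℂ) • e (n + 1) - e n := by
      simp [Algebra.algebraMap_eq_smul_one, hp, hq]
    rw [h4, hsucc]; module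

/-- Approximate eigenvectors of the free Jacobi operator. -/
lemma jacobi_telescope {e : ℕ → H} {D : H →L[ℂ] H}
    (hsucc : ∀ n, (4 : ℂ) • D (e (n + 1)) = e n + (2 : ℂ) • e (n + 1) + e (n + 2))
    {z : ℂ} (hz : z ≠ 0) (N L : ℕ) :
    (4 : ℂ) • D (∑ j ∈ Finset.range L, z ^ j • e (N + 1 + j))
      - (2 + z + z⁻¹) • ∑ j ∈ Finset.range L, z ^ j • e (N + 1 + j)
      = e N - z ^ L • e (N + L) + (z⁻¹ * z ^ L) • e (N + 1 + L) - z⁻¹ • e (N + 1) := by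
  induction L with
  | zero => simp
  | succ L ih =>
    rw [Finset.sum_range_succ, map_add, smul_add, smul_add, map_smul, smul_comm (4 : ℂ),
      show N + 1 + L = N + L + 1 by ring, hsucc]
    rw [show N + 1 + L = N + L + 1 by ring] at ih
    have e1 : N + 1 + (L + 1) = N + L + 2 := by ring
    have e2 : N + (L + 1) = N + L + 1 := by ring
    rw [e1, e2, add_sub_add_comm, ih, pow_succ]
    have : z⁻¹ * (z ^ L * z) = z ^ L := by field_simp
    rw [this]
    simp only [smul_add, smul_smul]
    have h3 : (z⁻¹ * z ^ L) = z ^ L * z⁻¹ := mul_comm _ _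
    rw [h3]
    module

end Model

section Block

variable {H : Type*} [NormedAddCommGroup H] [InnerProductSpace ℂ H]

/-- The normalized geometric block `L^(-1/2) ∑_{j < L} zʲ e_{N + 1 + j}`. -/
def geomBlock (e : ℕ → H) (z : ℂ) (N L : ℕ) : H :=
  ((√L)⁻¹ : ℂ) • ∑ j ∈ Finset.range L, z ^ j • e (N + 1 + j)

lemma orthonormal_geomBlock {e : ℕ → H} (he : Orthonormal ℂ e) {k : ℕ} {z : Fin k → ℂ}
    (hz : ∀ i, ‖z i‖ = 1) {L : ℕ} (hL : 0 < L) :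
    Orthonormal ℂ fun i : Fin k => geomBlock e (z i) (i * L) L := by
  constructor
  · intro i
    have ho : Orthonormal ℂ (fun j => e (i * L + 1 + j)) := he.comp _ (add_right_injective _)
    have h1 : ‖∑ j ∈ Finset.range L, z i ^ j • e (i * L + 1 + j)‖ = √L := by
      rw [@norm_eq_sqrt_re_inner ℂ, ho.inner_sum]
      have : ∀ j ∈ Finset.range L, (starRingEnd ℂ) (z i ^ j) * z i ^ j = 1 := fun j _ => by
        rw [Complex.conj_mul', norm_pow, hz]; simp
      rw [Finset.sum_congr rfl this]
      simp
    simp only [geomBlock]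
    rw [norm_smul, h1, norm_inv, Complex.norm_real, Real.norm_of_nonneg (by positivity)]
    have : (0 : ℝ) < √L := by positivity
    field_simp
  · intro i j hij
    simp only [geomBlock, inner_smul_left, inner_smul_right, sum_inner, inner_sum]
    rw [Finset.sum_eq_zero, mul_zero]
    intro a ha
    refine mul_eq_zero_of_right _ (mul_eq_zero_of_right _ (Finset.sum_eq_zero fun b hb => ?_))
    rw [he.2, mul_zero]
    intro h
    rw [Finset.mem_range] at ha hb
    have hij' : (i : ℕ) ≠ j := Fin.val_ne_of_ne hij
    rcases lt_or_gt_of_ne hij' with h' | h'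
    · nlinarith
    · nlinarith

lemma LinearIsometryEquiv.map_geomBlock (W : H ≃ₗᵢ[ℂ] H) (e : ℕ → H) (z : ℂ) (N L : ℕ) :
    W (geomBlock e z N L) = geomBlock (fun n => W (e n)) z N L := by
  simp [geomBlock, map_sum]

lemma norm_jacobi_geomBlock_le {e : ℕ → H} (he : Orthonormal ℂ e) {D : H →L[ℂ] H}
    (hsucc : ∀ n, (4 : ℂ) • D (e (n + 1)) = e n + (2 : ℂ) • e (n + 1) + e (n + 2))
    {z : ℂ} (hz : ‖z‖ = 1) {lam : ℂ} (hlam : 4 * lam = 2 + z + z⁻¹) (N L : ℕ) :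
    ‖D (geomBlock e z N L) - lam • geomBlock e z N L‖ ≤ (√L)⁻¹ := by
  have hz0 : z ≠ 0 := by rintro rfl; simp at hz
  have h1 : D (geomBlock e z N L) - lam • geomBlock e z N L = ((√L)⁻¹ * 4⁻¹ : ℂ) •
      (e N - z ^ L • e (N + L) + (z⁻¹ * z ^ L) • e (N + 1 + L) - z⁻¹ • e (N + 1)) := by
    rw [← jacobi_telescope hsucc hz0, ← hlam, geomBlock, map_smul]
    module
  have h2 : ‖e N - z ^ L • e (N + L) + (z⁻¹ * z ^ L) • e (N + 1 + L) - z⁻¹ • e (N + 1)‖ ≤ 4 := by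
    refine (norm_sub_le _ _).trans ?_
    refine (add_le_add_left ((norm_add_le _ _).trans (add_le_add_left (norm_sub_le _ _) _)) _).trans
      ?_
    simp only [norm_smul, he.1, norm_mul, norm_inv, norm_pow, hz]
    norm_num
  rw [h1, norm_smul, norm_mul, Complex.norm_real, Real.norm_of_nonneg (by positivity)]
  calc (√L)⁻¹ * ‖(4⁻¹ : ℂ)‖ * _ ≤ (√L)⁻¹ * ‖(4⁻¹ : ℂ)‖ * 4 := by gcongr
    _ = (√L)⁻¹ := by rw [norm_inv]; simp

lemma exists_unimodular_add_inv {t : ℝ} (h0 : 0 ≤ t) (h1 : t ≤ 1) :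
    ∃ z : ℂ, ‖z‖ = 1 ∧ 4 * (t : ℂ) = 2 + z + z⁻¹ := by
  refine ⟨Complex.exp (Real.arccos (2 * t - 1) * Complex.I), Complex.norm_exp_ofReal_mul_I _, ?_⟩
  have h2 := Complex.two_cos (Real.arccos (2 * t - 1) : ℂ)
  rw [← Complex.ofReal_cos, Real.cos_arccos (by linarith) (by linarith)] at h2
  rw [← Complex.exp_neg, ← neg_mul, add_assoc, ← h2]
  push_cast
  ring

end Block

section Unitary

variable {H : Type*} [NormedAddCommGroup H] [InnerProductSpace ℂ H]

/-- In a finite-dimensional space, any two orthonormal families are related by a unitary. -/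
lemma exists_unitary_finiteDimensional [FiniteDimensional ℂ H] {k : ℕ} {u y : Fin k → H}
    (hu : Orthonormal ℂ u) (hy : Orthonormal ℂ y) : ∃ W : H ≃ₗᵢ[ℂ] H, ∀ i, W (u i) = y i := by
  have hk : k ≤ Module.finrank ℂ H := by
    simpa using hu.linearIndependent.fintype_card_le_finrank
  have hext : ∀ v : Fin k → H, Orthonormal ℂ v →
      ∃ b : OrthonormalBasis (Fin (Module.finrank ℂ H)) ℂ H, ∀ i, b (Fin.castLE hk i) = v i := by
    intro v hv
    let v' : Fin (Module.finrank ℂ H) → H := fun i => if h : (i : ℕ) < k then v ⟨i, h⟩ else 0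
    have hv' : Orthonormal ℂ (Set.domRestrict {i : Fin (Module.finrank ℂ H) | (i : ℕ) < k} v') := by
      have : Set.domRestrict {i : Fin (Module.finrank ℂ H) | (i : ℕ) < k} v'
          = v ∘ fun i => ⟨i.1.1, i.2⟩ := by
        ext i
        have := i.2
        simp only [Set.mem_ofPred_eq] at this
        simp [v', this]
      rw [this]
      refine hv.comp _ fun a b hab => ?_
      ext
      simpa using hab
    obtain ⟨b, hb⟩ := hv'.exists_orthonormalBasis_extension_of_card_eq (by simp)
    exact ⟨b, fun i => by rw [hb _ (by simp)]; simp [v']⟩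
  obtain ⟨b, hb⟩ := hext u hu
  obtain ⟨c, hc⟩ := hext y hy
  exact ⟨b.equiv c (Equiv.refl _), fun i => by rw [← hb, ← hc]; simp⟩

/-- A unitary of a subspace extends to the whole space. -/
lemma exists_unitary_extension (G : Submodule ℂ H) [G.HasOrthogonalProjection]
    (U : G ≃ₗᵢ[ℂ] G) : ∃ W : H ≃ₗᵢ[ℂ] H, ∀ x : G, W x = U x := by
  let ext : (G ≃ₗᵢ[ℂ] G) → H → H := fun V x =>
    (V (G.orthogonalProjectionOnto x) : H) + (x - G.orthogonalProjectionOnto x)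
  have hcomp : ∀ V V' x, ext V (ext V' x) = ext (V'.trans V) x := by
    intro V V' x
    have : G.orthogonalProjectionOnto (ext V' x) = V' (G.orthogonalProjectionOnto x) := by
      simp only [ext, map_add, map_sub, Submodule.orthogonalProjectionOnto_mem_subspace_eq_self]
      simp
    simp only [ext] at this ⊢
    rw [this]
    simp
  have hrefl : ∀ x, ext (LinearIsometryEquiv.refl ℂ G) x = x := fun x => by simp [ext]
  let e : H ≃ₗ[ℂ] H :=
    { toFun := ext U
      map_add' := fun x y => by simp [ext]; abel
      map_smul' := fun c x => by simp [ext, smul_sub]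
      invFun := ext U.symm
      left_inv := fun x => by rw [hcomp, U.self_trans_symm, hrefl]
      right_inv := fun x => by rw [hcomp, U.symm_trans_self, hrefl] }
  refine ⟨⟨e, fun x => ?_⟩, fun x => ?_⟩
  · have horth : ∀ g : G, ⟪(g : H), x - G.orthogonalProjectionOnto x⟫_ℂ = 0 := fun g =>
      Submodule.inner_right_of_mem_orthogonal g.2 (G.sub_starProjection_mem_orthogonal x)
    have h1 := norm_add_sq_eq_norm_sq_add_norm_sq_of_inner_eq_zero _ _
      (horth (U (G.orthogonalProjectionOnto x)))
    have h2 := norm_add_sq_eq_norm_sq_add_norm_sq_of_inner_eq_zero _ _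
      (horth (G.orthogonalProjectionOnto x))
    rw [add_sub_cancel] at h2
    have h3 : ‖(U (G.orthogonalProjectionOnto x) : H)‖ = ‖(G.orthogonalProjectionOnto x : H)‖ :=
      U.norm_map (G.orthogonalProjectionOnto x)
    rw [h3, ← h2] at h1
    exact (mul_self_inj (norm_nonneg _) (norm_nonneg _)).mp h1
  · change ext U x = U x
    simp [ext]

/-- Any two finite orthonormal families of the same size are related by a unitary. -/
lemma exists_unitary_of_orthonormal {k : ℕ} {u y : Fin k → H}
    (hu : Orthonormal ℂ u) (hy : Orthonormal ℂ y) : ∃ W : H ≃ₗᵢ[ℂ] H, ∀ i, W (u i) = y i := by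
  let G : Submodule ℂ H := Submodule.span ℂ (Set.range u ∪ Set.range y)
  have : FiniteDimensional ℂ G :=
    FiniteDimensional.span_of_finite ℂ ((Set.finite_range u).union (Set.finite_range y))
  have hmem : ∀ i, u i ∈ G ∧ y i ∈ G := fun i =>
    ⟨Submodule.subset_span (Or.inl ⟨i, rfl⟩), Submodule.subset_span (Or.inr ⟨i, rfl⟩)⟩
  have hu' : Orthonormal ℂ (fun i => (⟨u i, (hmem i).1⟩ : G)) :=
    (G.subtypeₗᵢ.orthonormal_comp_iff).mp hu
  have hy' : Orthonormal ℂ (fun i => (⟨y i, (hmem i).2⟩ : G)) :=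
    (G.subtypeₗᵢ.orthonormal_comp_iff).mp hy
  obtain ⟨U, hU⟩ := exists_unitary_finiteDimensional hu' hy'
  obtain ⟨W, hW⟩ := exists_unitary_extension G U
  exact ⟨W, fun i => by rw [hW ⟨u i, (hmem i).1⟩, hU]⟩

end Unitary

section Cyclic

variable {H : Type*} [NormedAddCommGroup H] [InnerProductSpace ℂ H]

open Polynomial

lemma mem_span_orbit_iff {A : H →L[ℂ] H} {v x : H} :
    x ∈ Submodule.span ℂ (Set.range fun k : ℕ => (A ^ k) v) ↔ ∃ p : ℂ[X], aeval A p v = x := by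
  constructor
  · intro hx
    induction hx using Submodule.span_induction with
    | mem x hx => obtain ⟨k, rfl⟩ := hx; exact ⟨X ^ k, by simp⟩
    | zero => exact ⟨0, by simp⟩
    | add x y _ _ hx hy =>
      obtain ⟨p, rfl⟩ := hx
      obtain ⟨q, rfl⟩ := hy
      exact ⟨p + q, by simp⟩
    | smul c x _ hx => obtain ⟨p, rfl⟩ := hx; exact ⟨c • p, by simp⟩
  · rintro ⟨p, rfl⟩
    rw [aeval_eq_sum_range, sum_apply]
    exact Submodule.sum_mem _ fun k _ =>
      Submodule.smul_mem _ _ (Submodule.subset_span ⟨k, rfl⟩)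

lemma aeval_apply_mem_of_invariant {A : H →L[ℂ] H} {N : Submodule ℂ H}
    (hN : ∀ x ∈ N, A x ∈ N) (p : ℂ[X]) {x : H} (hx : x ∈ N) : aeval A p x ∈ N := by
  have hpow : ∀ k : ℕ, (A ^ k) x ∈ N := by
    intro k
    induction k with
    | zero => simpa
    | succ k ih => rw [pow_succ']; exact hN _ ih
  rw [aeval_eq_sum_range, sum_apply]
  exact Submodule.sum_mem _ fun k _ => Submodule.smul_mem _ _ (hpow k)

/-- A nonzero polynomial in an operator without eigenvalues is injective. -/
lemma aeval_injective_of_no_eigenvalue {A : H →L[ℂ] H}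
    (hA : ∀ (μ : ℂ) (y : H), A y = μ • y → y = 0) {p : ℂ[X]} (hp : p ≠ 0) {x : H}
    (hx : aeval A p x = 0) : x = 0 := by
  induction hn : p.natDegree generalizing p with
  | zero =>
    obtain ⟨c, rfl⟩ := natDegree_eq_zero.mp hn
    have hc : c ≠ 0 := by simpa using hp
    simpa [Algebra.algebraMap_eq_smul_one, hc] using hx
  | succ n ih =>
    obtain ⟨μ, hμ⟩ := IsAlgClosed.exists_root p fun h => by
      have := natDegree_eq_of_degree_eq_some (n := 0) h
      omega
    obtain ⟨q, rfl⟩ := dvd_iff_isRoot.mpr hμ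
    have hq : q ≠ 0 := right_ne_zero_of_mul hp
    refine ih hq (hA μ _ ?_) ?_
    · rw [map_mul] at hx
      simpa [Algebra.algebraMap_eq_smul_one, sub_eq_zero] using hx
    · rw [natDegree_mul (X_sub_C_ne_zero μ) hq, natDegree_X_sub_C] at hn
      omega

/-- If a self-adjoint operator has no eigenvalues, then the closed cyclic subspace of any nonzero
vector `p(A) f` contains every `q(A) f`. -/
lemma mem_closure_orbit_of_no_eigenvalue [CompleteSpace H] {A : H →L[ℂ] H} (hsa : IsSelfAdjoint A)
    (hA : ∀ (μ : ℂ) (y : H), A y = μ • y → y = 0) {f : H} {p : ℂ[X]} (hp : aeval A p f ≠ 0)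
    (q : ℂ[X]) :
    aeval A q f ∈
      closure (Submodule.span ℂ (Set.range fun k : ℕ => (A ^ k) (aeval A p f)) : Set H) := by
  set M₀ := Submodule.span ℂ (Set.range fun k : ℕ => (A ^ k) (aeval A p f))
  let M := M₀.topologicalClosure
  have hM₀ : ∀ x ∈ M₀, A x ∈ M₀ := fun x hx => by
    obtain ⟨r, rfl⟩ := mem_span_orbit_iff.mp hx
    exact mem_span_orbit_iff.mpr ⟨X * r, by simp⟩
  have hM : ∀ x ∈ M, A x ∈ M := fun x hx => map_mem_closure A.continuous hx hM₀
  have hMo : ∀ x ∈ Mᗮ, A x ∈ Mᗮ := fun x hx => by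
    rw [Submodule.mem_orthogonal] at hx ⊢
    intro u hu
    have : ⟪A u, x⟫_ℂ = ⟪u, A x⟫_ℂ := hsa.isSymmetric u x
    rw [← this, hx _ (hM u hu)]
  have hp0 : p ≠ 0 := by rintro rfl; simp at hp
  have hpf : aeval A p f ∈ M :=
    subset_closure (mem_span_orbit_iff.mpr ⟨1, by simp⟩)
  have hPf : M.starProjection f ∈ M := M.starProjection_apply_mem f
  have h1 : aeval A p (f - M.starProjection f) ∈ Mᗮ :=
    aeval_apply_mem_of_invariant hMo p (M.sub_starProjection_mem_orthogonal f)
  have h2 : aeval A p (f - M.starProjection f) ∈ M := by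
    rw [map_sub]
    exact M.sub_mem hpf (aeval_apply_mem_of_invariant hM p hPf)
  have h3 : aeval A p (f - M.starProjection f) = 0 :=
    inner_self_eq_zero.mp ((M.mem_orthogonal _).mp h1 _ h2)
  have h4 : f ∈ M := by
    rw [sub_eq_zero.mp (aeval_injective_of_no_eigenvalue hA hp0 h3)]
    exact hPf
  exact aeval_apply_mem_of_invariant hM q h4

end Cyclic

section Density

variable {H : Type*} [NormedAddCommGroup H] [InnerProductSpace ℂ H] [CompleteSpace H]

open Polynomial

/-- The data of a nearly diagonal operator: for any orthonormal `u` and prescribed diagonal entries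
in `[0, 1]`, some eigenvalue-free positive contraction almost has `u` as eigenvectors, and all of
`u` lies in one cyclic subspace. -/
lemma exists_nearly_diagonal [TopologicalSpace.SeparableSpace H] (hinf : ¬ FiniteDimensional ℂ H)
    {k : ℕ} {u : Fin k → H} (hu : Orthonormal ℂ u) {lam : Fin k → ℝ}
    (h0 : ∀ i, 0 ≤ lam i) (h1 : ∀ i, lam i ≤ 1) {L : ℕ} (hL : 0 < L) :
    ∃ A ∈ posUnitBall H, (∀ (μ : ℂ) (y : H), A y = μ • y → y = 0) ∧
      (∀ i, ‖A (u i) - (lam i : ℂ) • u i‖ ≤ (√L)⁻¹) ∧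
      ∃ f, ∀ x ∈ Submodule.span ℂ (Set.range u),
        x ∈ Submodule.span ℂ (Set.range fun n : ℕ => (A ^ n) f) := by
  obtain ⟨e⟩ := exists_hilbertBasis_nat hinf
  choose z hz hlam using fun i => exists_unimodular_add_inv (h0 i) (h1 i)
  obtain ⟨W, hW⟩ := exists_unitary_of_orthonormal hu (orthonormal_geomBlock e.orthonormal hz hL)
  let e' : HilbertBasis ℕ ℂ H := ⟨W.trans e.repr⟩
  have he' : ∀ n, e' n = W.symm (e n) := fun n => by
    rw [← e'.repr_symm_single, ← e.repr_symm_single]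
    rfl
  have hu' : ∀ i, u i = geomBlock e' (z i) (i * L) L := fun i => by
    rw [← W.symm_apply_apply (u i), hW, LinearIsometryEquiv.map_geomBlock]
    simp [← he']
  obtain ⟨A, hA, hA0, hAs⟩ := e'.exists_jacobi
  refine ⟨A, hA, fun μ y => e'.jacobi_injective hA.1 hA0 hAs, fun i => ?_, e' 0, ?_⟩
  · rw [hu']
    exact norm_jacobi_geomBlock_le e'.orthonormal hAs (hz i) (hlam i) _ _
  · intro x hx
    refine Submodule.span_le.mpr ?_ hx
    rintro _ ⟨i, rfl⟩
    rw [hu']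
    refine Submodule.smul_mem _ _ (Submodule.sum_mem _ fun j _ => Submodule.smul_mem _ _ ?_)
    obtain ⟨p, hp⟩ := jacobi_basis_mem hA0 hAs (i * L + 1 + j)
    exact mem_span_orbit_iff.mpr ⟨p, hp.symm⟩

/-- Any positive contraction can be approximated on finitely many vectors by a positive contraction
for which every nonzero vector of `V` has `w` in its closed cyclic subspace. -/
lemma exists_approx_cyclic [TopologicalSpace.SeparableSpace H] (hinf : ¬ FiniteDimensional ℂ H)
    {A₀ : H →L[ℂ] H} (hA₀ : A₀ ∈ posUnitBall H) (V : Submodule ℂ H) [FiniteDimensional ℂ V]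
    (w : H) (s : Finset H) {ε : ℝ} (hε : 0 < ε) :
    ∃ A ∈ posUnitBall H, (∀ x ∈ s, ‖A x - A₀ x‖ < ε) ∧ ∀ v ∈ V, v ≠ 0 →
      w ∈ closure (Submodule.span ℂ (Set.range fun k : ℕ => (A ^ k) v) : Set H) := by
  let F : Submodule ℂ H := V ⊔ Submodule.span ℂ ({w} ∪ (s ∪ A₀ '' s))
  have : FiniteDimensional ℂ (Submodule.span ℂ ({w} ∪ (s ∪ A₀ '' s))) :=
    FiniteDimensional.span_of_finite ℂ
      ((Set.finite_singleton w).union (s.finite_toSet.union (s.finite_toSet.image _)))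
  have : FiniteDimensional ℂ F := Submodule.finiteDimensional_sup _ _
  have hwF : w ∈ F := Submodule.mem_sup_right (Submodule.subset_span (by simp))
  have hsF : ∀ x ∈ s, x ∈ F := fun x hx =>
    Submodule.mem_sup_right (Submodule.subset_span (Or.inr (Or.inl hx)))
  have hAF : ∀ x ∈ s, A₀ x ∈ F := fun x hx =>
    Submodule.mem_sup_right (Submodule.subset_span (Or.inr (Or.inr ⟨x, hx, rfl⟩)))
  let T : F →ₗ[ℂ] F := (F.orthogonalProjectionOnto ∘L A₀ ∘L F.subtypeL : F →L[ℂ] F)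
  have hTinner : ∀ x y : F, ⟪T x, y⟫_ℂ = ⟪A₀ x, (y : H)⟫_ℂ := fun x y => by
    simp [T]
  have hT : T.IsSymmetric := fun x y => by
    rw [hTinner, ← inner_conj_symm x, hTinner, inner_conj_symm]
    exact hA₀.1.isSymmetric (x : H) y
  let b := hT.eigenvectorBasis (n := Module.finrank ℂ F) rfl
  let lam := hT.eigenvalues (n := Module.finrank ℂ F) rfl
  have hb : ∀ i, T (b i) = (lam i : ℂ) • b i := hT.apply_eigenvectorBasis rfl
  have hlam : ∀ i, ⟪A₀ (b i), (b i : H)⟫_ℂ = lam i := fun i => by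
    rw [← hTinner, hb, inner_smul_left, inner_self_eq_norm_sq_to_K, b.orthonormal.1]
    simp
  have hu : Orthonormal ℂ fun i => (b i : H) := F.subtypeₗᵢ.orthonormal_comp_iff.mpr b.orthonormal
  have hlam0 : ∀ i, 0 ≤ lam i := fun i => by
    have := (hA₀.2 (b i)).1
    rw [hlam] at this
    exact_mod_cast this
  have hlam1 : ∀ i, lam i ≤ 1 := fun i => by
    have := (hA₀.2 (b i)).2
    rw [hlam, hu.1] at this
    norm_num at this
    exact_mod_cast this
  let C : ℝ := ∑ x ∈ s, ∑ i, ‖⟪(b i : H), x⟫_ℂ‖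
  obtain ⟨L, hL⟩ := exists_nat_gt ((C / ε) ^ 2)
  have hC : 0 ≤ C := by positivity
  have hL0 : 0 < L := by
    have : (0 : ℝ) < L := lt_of_le_of_lt (by positivity) hL
    exact_mod_cast this
  have hCL : C * (√L)⁻¹ < ε := by
    have h1 : C / ε < √L := Real.lt_sqrt_of_sq_lt hL
    have h2 : 0 < √(L : ℝ) := by positivity
    rw [div_lt_iff₀ hε] at h1
    rw [← div_eq_mul_inv, div_lt_iff₀ h2]
    linarith
  obtain ⟨A, hA, hinj, hnear, f, hf⟩ := exists_nearly_diagonal hinf hu hlam0 hlam1 hL0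
  have hspan : ∀ x ∈ F, x ∈ Submodule.span ℂ (Set.range fun i => (b i : H)) := fun x hx => by
    have := congrArg (Subtype.val) (b.sum_repr ⟨x, hx⟩)
    simp only [Submodule.coe_sum, Submodule.coe_smul] at this
    rw [← this]
    exact Submodule.sum_mem _ fun i _ => Submodule.smul_mem _ _ (Submodule.subset_span ⟨i, rfl⟩)
  refine ⟨A, hA, fun x hx => ?_, fun v hv hv0 => ?_⟩
  · have hx1 : x = ∑ i, ⟪(b i : H), x⟫_ℂ • (b i : H) := by
      have := congrArg (Subtype.val) (b.sum_repr' ⟨x, hsF x hx⟩)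
      simpa using this.symm
    have hx2 : A₀ x = ∑ i, ⟪(b i : H), x⟫_ℂ • (lam i : ℂ) • (b i : H) := by
      have h1 : T ⟨x, hsF x hx⟩ = ∑ i, ⟪(b i : H), x⟫_ℂ • (lam i : ℂ) • b i := by
        conv_lhs => rw [← b.sum_repr' ⟨x, hsF x hx⟩]
        simp [hb]
      have h2 : (T ⟨x, hsF x hx⟩ : H) = A₀ x :=
        Submodule.starProjection_eq_self_iff.mpr (hAF x hx)
      rw [← h2, h1]
      simp
    have hx3 : A x - A₀ x
        = ∑ i, ⟪(b i : H), x⟫_ℂ • (A (b i) - (lam i : ℂ) • (b i : H)) := by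
      rw [hx2]
      conv_lhs => rw [hx1, map_sum]
      simp only [smul_sub, Finset.sum_sub_distrib, map_smul, ← hx1]
    calc ‖A x - A₀ x‖ ≤ ∑ i, ‖⟪(b i : H), x⟫_ℂ‖ * (√L)⁻¹ := by
          rw [hx3]
          refine norm_sum_le_of_le _ fun i _ => ?_
          rw [norm_smul]
          gcongr
          exact hnear i
      _ = (∑ i, ‖⟪(b i : H), x⟫_ℂ‖) * (√L)⁻¹ := by rw [Finset.sum_mul]
      _ ≤ C * (√L)⁻¹ := by
          gcongr
          exact Finset.single_le_sum (f := fun x => ∑ i, ‖⟪(b i : H), x⟫_ℂ‖)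
            (fun _ _ => by positivity) hx
      _ < ε := hCL
  · obtain ⟨p, rfl⟩ := mem_span_orbit_iff.mp (hf v (hspan v (Submodule.mem_sup_left hv)))
    obtain ⟨q, rfl⟩ := mem_span_orbit_iff.mp (hf w (hspan w hwF))
    exact mem_closure_orbit_of_no_eigenvalue hA.1 hinj hv0 q

end Density

section StrongTopology

variable {H : Type*} [NormedAddCommGroup H] [InnerProductSpace ℂ H] [CompleteSpace H]

open Polynomial

attribute [local instance] sot

lemma norm_apply_le_of_mem_posUnitBall {A : H →L[ℂ] H} (hA : A ∈ posUnitBall H) (v : H) :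
    ‖A v‖ ≤ ‖v‖ := by
  obtain ⟨h0, h1⟩ := mem_posUnitBall_iff.mp hA
  have h : ‖A‖ ≤ 1 := (CStarAlgebra.norm_le_one_iff_of_nonneg A
    ((ContinuousLinearMap.nonneg_iff_isPositive A).mpr h0)).mpr h1
  simpa using A.le_of_opNorm_le h v

lemma continuous_sot_apply (v : H) : Continuous fun A : posUnitBall H => (A : H →L[ℂ] H) v :=
  (continuous_apply v).comp continuous_induced_dom

/-- On the positive unit ball, evaluation is jointly continuous for the strong topology. -/
lemma continuous_sot_eval :
    Continuous fun z : posUnitBall H × H => (z.1 : H →L[ℂ] H) z.2 := by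
  rw [continuous_iff_continuousAt]
  rintro ⟨A₀, v₀⟩
  rw [ContinuousAt, tendsto_iff_norm_sub_tendsto_zero]
  have h1 : Filter.Tendsto (fun z : posUnitBall H × H =>
      ‖z.2 - v₀‖ + ‖(z.1 : H →L[ℂ] H) v₀ - (A₀ : H →L[ℂ] H) v₀‖) (nhds (A₀, v₀)) (nhds 0) := by
    have : Continuous (fun z : posUnitBall H × H =>
        ‖z.2 - v₀‖ + ‖(z.1 : H →L[ℂ] H) v₀ - (A₀ : H →L[ℂ] H) v₀‖) :=
      (continuous_snd.sub continuous_const).norm.add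
        (((continuous_sot_apply v₀).comp continuous_fst).sub continuous_const).norm
    simpa using this.tendsto (A₀, v₀)
  refine squeeze_zero (fun _ => norm_nonneg _) (fun z => ?_) h1
  have : (z.1 : H →L[ℂ] H) z.2 - (A₀ : H →L[ℂ] H) v₀ = (z.1 : H →L[ℂ] H) (z.2 - v₀)
      + ((z.1 : H →L[ℂ] H) v₀ - (A₀ : H →L[ℂ] H) v₀) := by
    rw [map_sub]; abel
  rw [this]
  exact (norm_add_le _ _).trans
    (add_le_add_left (norm_apply_le_of_mem_posUnitBall z.1.2 _) _)

lemma continuous_sot_aeval (p : ℂ[X]) :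
    Continuous fun z : posUnitBall H × H => aeval (z.1 : H →L[ℂ] H) p z.2 := by
  have hpow : ∀ k : ℕ, Continuous fun z : posUnitBall H × H => ((z.1 : H →L[ℂ] H) ^ k) z.2 := by
    intro k
    induction k with
    | zero => simpa using continuous_snd
    | succ k ih =>
      simp only [pow_succ']
      exact continuous_sot_eval.comp (continuous_fst.prodMk ih)
  simp only [aeval_eq_sum_range, sum_apply]
  exact continuous_finsetSum _ fun k _ => (hpow k).const_smul _

/-- For compact `K`, approximating `w` within `ε` from every cyclic subspace generated in `K` is
a strongly open condition. -/
lemma isOpen_sot_approx {K : Set H} (hK : IsCompact K) (w : H) (ε : ℝ) :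
    IsOpen {A : posUnitBall H | ∀ v ∈ K, ∃ p : ℂ[X], ‖aeval (A : H →L[ℂ] H) p v - w‖ < ε} := by
  rw [isOpen_iff_eventually]
  intro A hA
  refine hK.eventually_forall_of_forall_eventually fun v hv => ?_
  obtain ⟨p, hp⟩ := hA v hv
  have h : IsOpen {z : posUnitBall H × H | ‖aeval (z.1 : H →L[ℂ] H) p z.2 - w‖ < ε} :=
    isOpen_lt (f := fun z : posUnitBall H × H => ‖aeval (z.1 : H →L[ℂ] H) p z.2 - w‖)
      ((continuous_sot_aeval p).sub continuous_const).norm continuous_const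
  filter_upwards [h.mem_nhds hp] with z hz using ⟨p, hz⟩

/-- A set of operators is strongly dense if it meets every finite approximation condition. -/
lemma dense_sot_of_approx {U : Set (posUnitBall H)}
    (hU : ∀ A₀ : posUnitBall H, ∀ s : Finset H, ∀ ε > 0, ∃ A ∈ U,
      ∀ x ∈ s, ‖(A : H →L[ℂ] H) x - (A₀ : H →L[ℂ] H) x‖ < ε) : Dense U := by
  intro A₀
  refine (closure_induced
    (f := fun A : posUnitBall H => ((A : H →L[ℂ] H) : H → H))).mpr ?_
  rw [mem_closure_iff]
  intro O hO hAO
  obtain ⟨I, u, hu, hsub⟩ := isOpen_pi_iff.mp hO _ hAO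
  have hev : ∀ᶠ ε : ℝ in nhdsWithin 0 (Set.Ioi 0), ∀ x ∈ I,
      Metric.ball ((A₀ : H →L[ℂ] H) x) ε ⊆ u x := by
    rw [Filter.eventually_all_finset]
    intro x hx
    obtain ⟨r, hr, hrs⟩ := Metric.isOpen_iff.mp (hu x hx).1 _ (hu x hx).2
    filter_upwards [Ioo_mem_nhdsGT hr] with ε hε
    exact (Metric.ball_subset_ball hε.2.le).trans hrs
  obtain ⟨ε, hε, hεpos⟩ := (hev.and self_mem_nhdsWithin).exists
  obtain ⟨A, hA, hAnear⟩ := hU A₀ I ε hεpos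
  refine ⟨_, hsub fun x hx => hε x hx ?_, Set.mem_image_of_mem _ hA⟩
  rw [mem_ball_iff_norm]
  exact hAnear x hx

lemma residual_sot_of_finiteDimensional [TopologicalSpace.SeparableSpace H]
    (hinf : ¬ FiniteDimensional ℂ H) (V : Submodule ℂ H) [FiniteDimensional ℂ V] :
    ∀ᶠ A : posUnitBall H in residual (posUnitBall H), ∀ v ∈ V, v ≠ 0 →
      Dense (Submodule.span ℂ (Set.range fun k : ℕ => ((A : H →L[ℂ] H) ^ k) v) : Set H) := by
  let K : Set H := Subtype.val '' Metric.sphere (0 : V) 1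
  have hK : IsCompact K := (isCompact_sphere (0 : V) 1).image continuous_subtype_val
  have hall : ∀ᶠ A : posUnitBall H in residual (posUnitBall H), ∀ n m : ℕ, ∀ v ∈ K,
      ∃ p : ℂ[X], ‖aeval (A : H →L[ℂ] H) p v - TopologicalSpace.denseSeq H n‖ < 1 / (m + 1) := by
    rw [eventually_countable_forall]
    intro n
    rw [eventually_countable_forall]
    intro m
    refine residual_of_dense_open (isOpen_sot_approx hK _ _)
      (dense_sot_of_approx fun A₀ s ε hε => ?_)
    obtain ⟨A, hA, hnear, hcyc⟩ :=
      exists_approx_cyclic hinf A₀.2 V (TopologicalSpace.denseSeq H n) s hε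
    refine ⟨⟨A, hA⟩, ?_, hnear⟩
    rintro _ ⟨v, hv, rfl⟩
    have hv0 : (v : H) ≠ 0 := by
      have : ‖(v : H)‖ = 1 := by simpa using hv
      rintro h
      simp [h] at this
    obtain ⟨x, hx, hxd⟩ := Metric.mem_closure_iff.mp (hcyc v v.2 hv0) (1 / (m + 1)) (by positivity)
    obtain ⟨p, rfl⟩ := mem_span_orbit_iff.mp hx
    exact ⟨p, by rwa [← dist_eq_norm, dist_comm]⟩
  filter_upwards [hall] with A hA v hv hv0
  have hnorm : (‖v‖ : ℂ) ≠ 0 := by simpa using hv0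
  have hmem : (‖v‖⁻¹ : ℂ) • v ∈ K := by
    refine ⟨⟨(‖v‖⁻¹ : ℂ) • v, V.smul_mem _ hv⟩, ?_, rfl⟩
    rw [mem_sphere_zero_iff_norm, Submodule.coe_norm, norm_smul]
    simp [hv0]
  refine fun x => Metric.mem_closure_iff.mpr fun ε hε => ?_
  obtain ⟨m, hm⟩ := exists_nat_one_div_lt (half_pos hε)
  obtain ⟨n, hn⟩ := (TopologicalSpace.denseRange_denseSeq H).exists_dist_lt x (half_pos hε)
  obtain ⟨p, hp⟩ := hA n m _ hmem
  rw [map_smul] at hp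
  refine ⟨_, Submodule.smul_mem _ (‖v‖⁻¹ : ℂ) (mem_span_orbit_iff.mpr ⟨p, rfl⟩), ?_⟩
  rw [← dist_eq_norm, dist_comm] at hp
  linarith [dist_triangle x (TopologicalSpace.denseSeq H n)
    ((‖v‖⁻¹ : ℂ) • aeval (A : H →L[ℂ] H) p v)]

end StrongTopology

/-- Let `H` be a separable, infinite-dimensional complex Hilbert space and `S` a countable
subset of `H`.  Then the set of operators in the positive part of the closed unit ball of
`B(H)` for which every nonzero vector in the span of `S` is cyclic is comeager for the
relative strong operator topology. -/
theorem comeager_cyclic_of_countable (H : Type*) [NormedAddCommGroup H]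
    [InnerProductSpace ℂ H] [CompleteSpace H] [TopologicalSpace.SeparableSpace H]
    (hinf : ¬ FiniteDimensional ℂ H) (S : Set H) (hS : S.Countable) :
    {A : posUnitBall H | ∀ v ∈ Submodule.span ℂ S, v ≠ 0 →
        Dense ((Submodule.span ℂ
          (Set.range fun k : ℕ => ((A : H →L[ℂ] H) ^ k) v) : Submodule ℂ H) : Set H)}
      ∈ @residual (posUnitBall H) (sot H) := by
  let := sot H
  have : Countable S := hS.to_subtype
  have hall : ∀ᶠ A : posUnitBall H in residual (posUnitBall H), ∀ t : Finset S,
      ∀ v ∈ Submodule.span ℂ (Subtype.val '' (t : Set S)), v ≠ 0 →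
      Dense (Submodule.span ℂ (Set.range fun k : ℕ => ((A : H →L[ℂ] H) ^ k) v) : Set H) := by
    rw [eventually_countable_forall]
    intro t
    have := FiniteDimensional.span_of_finite ℂ (t.finite_toSet.image Subtype.val)
    exact residual_sot_of_finiteDimensional hinf _
  filter_upwards [hall] with A hA v hv hv0
  obtain ⟨t, htS, htv⟩ := Submodule.mem_span_finite_of_mem_span hv
  classical
  refine hA (t.subtype (· ∈ S)) v (Submodule.span_mono (fun x hx => ?_) htv) hv0
  exact ⟨⟨x, htS hx⟩, by simpa using hx, rfl⟩
end
end

section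
/- Let H be a separable, infinite-dimensional complex Hilbert space, let E be a finite-dimensional subspace of H, let x ∈ H, and let δ > 0. Then the set U of operators A in the positive part of the closed unit ball of B(H) such that dist(x, span{Aᵏv : k ∈ ℕ}) < δ for every nonzero v ∈ E is open in the positive part of the closed unit ball of B(H) equipped with the relative strong operator topology. -/
open scoped InnerProductSpace ComplexOrder

noncomputable section

/-- Operators in the positive part of the unit ball are contractions. -/
theorem norm_le_one_of_mem_posUnitBall {H : Type*} [NormedAddCommGroup H]
    [InnerProductSpace ℂ H] [CompleteSpace H] {A : H →L[ℂ] H} (hA : A ∈ posUnitBall H) :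
    ‖A‖ ≤ 1 := by
  have hpos : 0 ≤ A := by
    rw [ContinuousLinearMap.nonneg_iff_isPositive, ContinuousLinearMap.isPositive_iff_complex]
    intro v
    obtain ⟨hre, him⟩ := Complex.le_def.1 (hA.2 v).1
    exact ⟨Complex.ext rfl him, hre⟩
  rw [CStarAlgebra.norm_le_one_iff_of_nonneg A, ContinuousLinearMap.le_def,
    ContinuousLinearMap.isPositive_iff_complex]
  intro v
  obtain ⟨hre, him⟩ := Complex.le_def.1 (sub_nonneg.2 (hA.2 v).2)
  have h : ⟪(1 - A) v, v⟫_ℂ = ((‖v‖ ^ 2 : ℝ) : ℂ) - ⟪A v, v⟫_ℂ := by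
    simp [inner_self_eq_norm_sq_to_K]
  rw [h]
  exact ⟨Complex.ext rfl him, hre⟩

/-- A pointwise continuous family of contractions is jointly continuous. -/
theorem continuous_eval_of_norm_le_one {X H : Type*} [TopologicalSpace X] [NormedAddCommGroup H]
    [NormedSpace ℂ H] {T : X → H →L[ℂ] H} (hT : ∀ a, ‖T a‖ ≤ 1)
    (hc : ∀ v, Continuous fun a => T a v) :
    Continuous fun p : X × H => T p.1 p.2 :=
  (continuous_prod_of_continuous_lipschitzWith (fun p : H × X => T p.2 p.1) 1 hc
    fun a => (T a).lipschitz.weaken (hT a)).comp continuous_swap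

/-- The powers of a pointwise continuous family of contractions are jointly continuous. -/
theorem continuous_pow_eval_of_norm_le_one {X H : Type*} [TopologicalSpace X]
    [NormedAddCommGroup H] [NormedSpace ℂ H] {T : X → H →L[ℂ] H} (hT : ∀ a, ‖T a‖ ≤ 1)
    (hc : ∀ v, Continuous fun a => T a v) (k : ℕ) :
    Continuous fun p : X × H => (T p.1 ^ k) p.2 := by
  induction k with
  | zero => simpa using continuous_snd
  | succ k ih =>
    simp only [pow_succ', mul_apply_eq_comp]
    exact (continuous_eval_of_norm_le_one hT hc).comp (continuous_fst.prodMk ih)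

/-- For a pointwise continuous family `T` of contractions, the pairs `(a, v)` for which the orbit
of `v` under `T a` spans a subspace at distance less than `δ` from `x` form an open set. -/
theorem isOpen_infDist_span_orbit_lt {X H : Type*} [TopologicalSpace X] [NormedAddCommGroup H]
    [NormedSpace ℂ H] {T : X → H →L[ℂ] H} (hT : ∀ a, ‖T a‖ ≤ 1)
    (hc : ∀ v, Continuous fun a => T a v) (x : H) (δ : ℝ) :
    IsOpen {p : X × H | Metric.infDist x ((Submodule.span ℂ
      (Set.range fun k : ℕ => (T p.1 ^ k) p.2) : Submodule ℂ H) : Set H) < δ} := by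
  have h : {p : X × H | Metric.infDist x ((Submodule.span ℂ
      (Set.range fun k : ℕ => (T p.1 ^ k) p.2) : Submodule ℂ H) : Set H) < δ} =
      ⋃ c : ℕ →₀ ℂ, {p : X × H | dist x (c.sum fun k z => z • (T p.1 ^ k) p.2) < δ} := by
    ext p
    simp only [Set.mem_ofPred_eq, Set.mem_iUnion, Metric.infDist_lt_iff (Submodule.nonempty _),
      SetLike.mem_coe, Finsupp.mem_span_range_iff_exists_finsupp]
    constructor
    · rintro ⟨_, ⟨c, rfl⟩, hc⟩
      exact ⟨c, hc⟩
    · rintro ⟨c, hc⟩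
      exact ⟨_, ⟨c, rfl⟩, hc⟩
  rw [h]
  refine isOpen_iUnion fun c => isOpen_lt (continuous_const.dist ?_) continuous_const
  exact continuous_finsetSum _ fun k _ =>
    (continuous_pow_eval_of_norm_le_one hT hc k).const_smul (c k)

/-- For a pointwise continuous family `T` of contractions and a finite-dimensional subspace `E`,
the parameters `a` for which the orbit under `T a` of every nonzero vector of `E` spans a subspace
at distance less than `δ` from `x` form an open set. -/
theorem isOpen_forall_infDist_span_orbit_lt {X H : Type*} [TopologicalSpace X]
    [NormedAddCommGroup H] [NormedSpace ℂ H] {T : X → H →L[ℂ] H} (hT : ∀ a, ‖T a‖ ≤ 1)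
    (hc : ∀ v, Continuous fun a => T a v) (E : Submodule ℂ H) [FiniteDimensional ℂ E]
    (x : H) (δ : ℝ) :
    IsOpen {a : X | ∀ v ∈ E, v ≠ 0 → Metric.infDist x ((Submodule.span ℂ
      (Set.range fun k : ℕ => (T a ^ k) v) : Submodule ℂ H) : Set H) < δ} := by
  have : ProperSpace E := FiniteDimensional.proper ℂ E
  have hK : IsCompact (E.subtypeL '' Metric.sphere 0 1) :=
    (isCompact_sphere _ _).image E.subtypeL.continuous
  rw [isOpen_iff_eventually]
  intro A hA
  have hnear := hK.eventually_forall_of_forall_eventually (x₀ := A)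
    (P := fun B v => Metric.infDist x ((Submodule.span ℂ
      (Set.range fun k : ℕ => (T B ^ k) v) : Submodule ℂ H) : Set H) < δ) (by
    rintro _ ⟨v, hv, rfl⟩
    refine (isOpen_infDist_span_orbit_lt hT hc x δ).mem_nhds (hA v v.2 ?_)
    intro h
    simp [Submodule.coe_eq_zero.1 h] at hv)
  filter_upwards [hnear] with B hB v hvE hv
  refine (Metric.infDist_le_infDist_of_subset ?_ (Submodule.nonempty _)).trans_lt
    (hB (((‖v‖⁻¹ : ℝ) : ℂ) • v) ⟨⟨_, E.smul_mem _ hvE⟩, ?_, rfl⟩)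
  · refine Submodule.span_le.2 ?_
    rintro _ ⟨k, rfl⟩
    simp only [map_smul]
    exact Submodule.smul_mem _ _ (Submodule.subset_span ⟨k, rfl⟩)
  · simp [norm_smul, hv]

/-- Let `H` be a separable, infinite-dimensional complex Hilbert space, `E` a
finite-dimensional subspace of `H`, `x ∈ H` and `δ > 0`.  Then the set of operators `A`
in the positive part of the closed unit ball of `B(H)` such that
`dist(x, span {Aᵏ v : k ∈ ℕ}) < δ` for every nonzero `v ∈ E` is open for the relative
strong operator topology. -/
theorem isOpen_good_set (H : Type*) [NormedAddCommGroup H]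
    [InnerProductSpace ℂ H] [CompleteSpace H] [TopologicalSpace.SeparableSpace H]
    (hinf : ¬ FiniteDimensional ℂ H) (E : Submodule ℂ H) [FiniteDimensional ℂ E]
    (x : H) (δ : ℝ) (hδ : 0 < δ) :
    @IsOpen (posUnitBall H) (sot H)
      {A | ∀ v ∈ E, v ≠ 0 →
        Metric.infDist x ((Submodule.span ℂ
          (Set.range fun k : ℕ => ((A : H →L[ℂ] H) ^ k) v) : Submodule ℂ H) : Set H) < δ} := by
  exact @isOpen_forall_infDist_span_orbit_lt (posUnitBall H) H (sot H) _ _ (fun A => A)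
    (fun A => norm_le_one_of_mem_posUnitBall A.2)
    (fun v => @Continuous.comp _ _ _ (sot H) _ _ _ _ (continuous_apply v) continuous_induced_dom)
    E _ x δ
end
end

section
/- Let H be a separable, infinite-dimensional complex Hilbert space, let E be a finite-dimensional subspace of H, let x ∈ H with ‖x‖ ≤ 1, and let δ > 0. Then the set U of operators A in the positive part of the closed unit ball of B(H) such that dist(x, span{Aᵏv : k ∈ ℕ}) < δ for every nonzero v ∈ E is dense in the positive part of the closed unit ball of B(H) equipped with the relative strong operator topology. -/
open scoped InnerProductSpace ComplexOrder

noncomputable section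

open ComplexConjugate in
/-- Orthogonality of the monomials on the `N`-th roots of unity. -/
lemma sum_conj_pow_mul_pow_of_isPrimitiveRoot {N : ℕ} {ω : ℂ} (hω : IsPrimitiveRoot ω N)
    {i j : ℕ} (hi : i < N) (hj : j < N) :
    ∑ k : Fin N, conj ((ω ^ (k : ℕ)) ^ i) * (ω ^ (k : ℕ)) ^ j = if i = j then (N : ℂ) else 0 := by
  have hN : N ≠ 0 := by omega
  have hnorm : ‖ω‖ = 1 := hω.norm'_eq_one hN
  have hself : ∀ m : ℕ, conj (ω ^ m) * ω ^ m = 1 := fun m => by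
    rw [Complex.conj_mul']; simp [hnorm]
  set z : ℂ := conj (ω ^ i) * ω ^ j with hz
  have hterm : ∀ k : ℕ, conj ((ω ^ k) ^ i) * (ω ^ k) ^ j = z ^ k := fun k => by
    rw [hz, mul_pow, ← map_pow, ← pow_mul, ← pow_mul, ← pow_mul, ← pow_mul, mul_comm k, mul_comm k]
  simp only [hterm]
  rw [Fin.sum_univ_eq_sum_range (fun k => z ^ k) N]
  split_ifs with h
  · subst h
    simp only [hz, hself, one_pow]
    simp
  · have hz1 : z ≠ 1 := fun h1 => h <| hω.pow_inj hi hj <| by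
      calc ω ^ i = ω ^ i * z := by rw [h1, mul_one]
        _ = (conj (ω ^ i) * ω ^ i) * ω ^ j := by rw [hz]; ring
        _ = ω ^ j := by rw [hself, one_mul]
    have hzN : z ^ N = 1 := by
      rw [hz, mul_pow, ← map_pow, ← pow_mul, ← pow_mul, mul_comm i, mul_comm j, pow_mul, pow_mul,
        hω.pow_eq_one]
      simp
    have := mul_geom_sum z N
    rw [hzN, sub_self] at this
    exact (mul_eq_zero.mp this).resolve_left (sub_ne_zero.mpr hz1)

/-- The `j`-th function on `n` copies of the `N`-th roots of unity: a multiple of the indicator of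
the `j`-th copy, perturbed by the monomial `z ^ (j + 1)` on every copy. -/
def perturbedIndicator {n N : ℕ} (a b : ℝ) (ω : ℂ) (j : Fin n) (p : Fin n × Fin N) : ℂ :=
  ((√(N : ℝ))⁻¹ : ℝ) * ((if p.1 = j then (a : ℂ) else 0) + b * (ω ^ (p.2 : ℕ)) ^ ((j : ℕ) + 1))

open ComplexConjugate in
lemma orthonormal_perturbedIndicator {n N : ℕ} {a b : ℝ} {ω : ℂ} (hω : IsPrimitiveRoot ω N)
    (hN : n < N) (hab : a ^ 2 + n * b ^ 2 = 1) :
    Orthonormal ℂ fun j : Fin n =>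
      WithLp.toLp 2 (perturbedIndicator (n := n) (N := N) a b ω j) := by
  rw [orthonormal_iff_ite]
  intro j l
  have hj : (j : ℕ) + 1 < N := by omega
  have hl : (l : ℕ) + 1 < N := by omega
  have hNpos : (0 : ℝ) < N := by exact_mod_cast (by omega : 0 < N)
  have hs : (((√(N : ℝ))⁻¹ : ℝ) : ℂ) * ((√(N : ℝ))⁻¹ : ℝ) * N = 1 := by
    norm_cast
    rw [← mul_inv, Real.mul_self_sqrt hNpos.le, inv_mul_cancel₀ hNpos.ne']
  have h00 := sum_conj_pow_mul_pow_of_isPrimitiveRoot hω (i := 0) (j := 0) (by omega) (by omega)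
  have h0l := sum_conj_pow_mul_pow_of_isPrimitiveRoot hω (i := 0) (by omega) hl
  have hj0 := sum_conj_pow_mul_pow_of_isPrimitiveRoot hω (j := 0) hj (by omega)
  have hjl := sum_conj_pow_mul_pow_of_isPrimitiveRoot hω hj hl
  simp only [pow_zero, map_one, one_mul, mul_one, if_true, Nat.add_right_cancel_iff,
    Nat.succ_ne_zero, (Nat.succ_ne_zero _).symm, if_false, ← Fin.ext_iff] at h00 h0l hj0 hjl
  have hcopy : ∀ i : Fin n, ∑ k : Fin N,
      conj (perturbedIndicator a b ω j (i, k)) * perturbedIndicator a b ω l (i, k) =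
      (if i = j then (a : ℂ) else 0) * (if i = l then (a : ℂ) else 0)
        + b * b * (if j = l then 1 else 0) := by
    intro i
    set α : ℂ := if i = j then (a : ℂ) else 0
    have hα : conj α = α := by simp only [α]; split_ifs <;> simp
    set β : ℂ := if i = l then (a : ℂ) else 0
    set s : ℂ := (((√(N : ℝ))⁻¹ : ℝ) : ℂ) with hsdef
    have : ∀ k : Fin N,
        conj (perturbedIndicator a b ω j (i, k)) * perturbedIndicator a b ω l (i, k) =
        s * s * (α * β) * 1 + s * s * α * b * ((ω ^ (k : ℕ)) ^ ((l : ℕ) + 1))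
        + s * s * b * β * conj ((ω ^ (k : ℕ)) ^ ((j : ℕ) + 1))
        + s * s * b * b *
          (conj ((ω ^ (k : ℕ)) ^ ((j : ℕ) + 1)) * (ω ^ (k : ℕ)) ^ ((l : ℕ) + 1)) := by
      intro k
      simp only [perturbedIndicator, map_mul, map_add, Complex.conj_ofReal]
      rw [hα, ← hsdef]
      ring
    simp only [this, Finset.sum_add_distrib, ← Finset.mul_sum]
    rw [h00, h0l, hj0, hjl]
    split_ifs
    · linear_combination (α * β + b * b) * hs
    · linear_combination (α * β) * hs
  have : inner ℂ (WithLp.toLp 2 (perturbedIndicator (n := n) (N := N) a b ω j))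
      (WithLp.toLp 2 (perturbedIndicator (n := n) (N := N) a b ω l)) =
      ∑ i : Fin n, ∑ k : Fin N,
      conj (perturbedIndicator a b ω j (i, k)) * perturbedIndicator a b ω l (i, k) := by
    rw [PiLp.inner_apply, Fintype.sum_prod_type]
    simp [mul_comm]
  rw [this]
  simp only [hcopy, Finset.sum_add_distrib]
  have hab' : (a : ℂ) ^ 2 + n * (b : ℂ) ^ 2 = 1 := by exact_mod_cast hab
  by_cases h : j = l
  · subst h
    simp
    linear_combination hab'
  · have : ∀ i : Fin n, (if i = j then (a : ℂ) else 0) * (if i = l then (a : ℂ) else 0) = 0 := by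
      intro i
      split_ifs <;> simp_all
    simp [this, h]

open Polynomial in
/-- A nontrivial linear combination of the perturbed indicators has at most `n` zeros on each of
the `n` copies of the roots of unity. -/
lemma card_zeros_perturbedIndicator_le {n N : ℕ} {a b : ℝ} {ω : ℂ} (hω : IsPrimitiveRoot ω N)
    (hN : 0 < N) (hb : b ≠ 0) {c : Fin n → ℂ} (hc : c ≠ 0) :
    (Finset.univ.filter fun p : Fin n × Fin N =>
      ∑ j, c j * perturbedIndicator a b ω j p = 0).card ≤ n * n := by
  classical
  obtain ⟨j₀, hj₀⟩ := Function.ne_iff.mp hc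
  have hs : (((√(N : ℝ))⁻¹ : ℝ) : ℂ) ≠ 0 := by
    have : (0 : ℝ) < N := by exact_mod_cast hN
    exact_mod_cast (inv_pos.mpr (Real.sqrt_pos.mpr this)).ne'
  let P : Fin n → ℂ[X] := fun i => C (a * c i) + ∑ j : Fin n, C (b * c j) * X ^ ((j : ℕ) + 1)
  have hP : ∀ i, P i ≠ 0 := by
    intro i h
    have := congrArg (fun p : ℂ[X] => p.coeff ((j₀ : ℕ) + 1)) h
    simp [P, -map_mul, coeff_X_pow, ← Fin.ext_iff] at this
    tauto
  have hdeg : ∀ i, (P i).natDegree ≤ n := by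
    intro i
    refine natDegree_add_le_of_degree_le ((natDegree_C _).le.trans n.zero_le)
      (natDegree_sum_le_of_forall_le _ _ fun j _ => ?_)
    exact (natDegree_C_mul_X_pow_le _ _).trans (by omega)
  have heval : ∀ i (k : Fin N), ∑ j, c j * perturbedIndicator a b ω j (i, k) =
      ((√(N : ℝ))⁻¹ : ℝ) * (P i).eval (ω ^ (k : ℕ)) := by
    intro i k
    simp only [P, perturbedIndicator, eval_add, eval_C, eval_finsetSum, eval_mul, eval_pow, eval_X,
      mul_add, Finset.sum_add_distrib, Finset.mul_sum]
    congr 1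
    · simp; ring
    · exact Finset.sum_congr rfl fun j _ => by ring
  calc _ ≤ (Finset.univ.sigma fun i : Fin n => (P i).roots.toFinset).card := by
        refine Finset.card_le_card_of_injOn (fun p => ⟨p.1, ω ^ (p.2 : ℕ)⟩) ?_ ?_
        · rintro ⟨i, k⟩ hp
          simp only [Finset.coe_filter, Finset.mem_univ, true_and, Set.mem_ofPred_eq, heval] at hp
          simpa [hP] using (mul_eq_zero.mp hp).resolve_left hs
        · rintro ⟨i, k⟩ - ⟨i', k'⟩ - h
          simp only [Sigma.mk.injEq, heq_eq_eq] at h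
          exact Prod.ext h.1 (Fin.ext (hω.pow_inj k.2 k'.2 h.2))
    _ = ∑ i : Fin n, (P i).roots.toFinset.card := Finset.card_sigma _ _
    _ ≤ ∑ _i : Fin n, n := Finset.sum_le_sum fun i _ =>
        (Multiset.toFinset_card_le _).trans ((card_roots' _).trans (hdeg i))
    _ = n * n := by simp

lemma norm_perturbedIndicator_of_ne {n N : ℕ} {a b : ℝ} {ω : ℂ} (hω : ‖ω‖ = 1) {j : Fin n}
    {p : Fin n × Fin N} (hp : p.1 ≠ j) :
    ‖perturbedIndicator a b ω j p‖ = (√(N : ℝ))⁻¹ * |b| := by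
  rw [perturbedIndicator, norm_mul, if_neg hp, zero_add, norm_mul, norm_pow, norm_pow, hω,
    Complex.norm_real, Complex.norm_real, Real.norm_eq_abs, Real.norm_eq_abs,
    abs_of_nonneg (by positivity)]
  simp

lemma norm_perturbedIndicator_le {n N : ℕ} {a b : ℝ} {ω : ℂ} (hω : ‖ω‖ = 1) (ha : |a| ≤ 1)
    (hb : |b| ≤ 1) (j : Fin n) (p : Fin n × Fin N) :
    ‖perturbedIndicator a b ω j p‖ ≤ (√(N : ℝ))⁻¹ * 2 := by
  rw [perturbedIndicator, norm_mul, Complex.norm_real, Real.norm_eq_abs,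
    abs_of_nonneg (by positivity)]
  gcongr
  refine (norm_add_le _ _).trans ?_
  have h1 : ‖(if p.1 = j then (a : ℂ) else 0)‖ ≤ 1 := by
    split_ifs
    · simpa using ha
    · simp
  have h2 : ‖(b : ℂ) * (ω ^ (p.2 : ℕ)) ^ ((j : ℕ) + 1)‖ ≤ 1 := by
    simpa [hω] using hb
  linarith

/-- There are orthonormal functions `g j` on `n` copies of a large finite set such that `g j` is
concentrated on the `j`-th copy, and such that every function in the unit polydisc of their span
has small mass on the zero set of any other nonzero function in their span. -/
lemma exists_orthonormal_small_on_zeros (n : ℕ) {θ τ : ℝ} (hθ : 0 < θ) (hτ : 0 < τ) :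
    ∃ (N : ℕ) (g : Fin n → Fin n × Fin N → ℂ),
      (Orthonormal ℂ fun j => WithLp.toLp 2 (g j)) ∧
      (∀ j, ∑ p with p.1 ≠ j, ‖g j p‖ ^ 2 ≤ θ ^ 2) ∧
      ∀ c d : Fin n → ℂ, c ≠ 0 → (∀ j, ‖d j‖ ≤ 1) →
        ∑ p with ∑ j, c j * g j p = 0, ‖∑ j, d j * g j p‖ ≤ τ := by
  obtain ⟨N, hN⟩ := exists_nat_gt (max (n : ℝ) ((2 * n ^ 3 / τ) ^ 2))
  have hnN : n < N := by exact_mod_cast (le_max_left _ _).trans_lt hN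
  have hN0 : 0 < N := by omega
  have hNR : (0 : ℝ) < N := by exact_mod_cast hN0
  set ω := Complex.exp (2 * Real.pi * Complex.I / N)
  have hω : IsPrimitiveRoot ω N := Complex.isPrimitiveRoot_exp N hN0.ne'
  have hω1 : ‖ω‖ = 1 := hω.norm'_eq_one hN0.ne'
  set t := min θ 1
  have ht : 0 < t := lt_min hθ one_pos
  have ht1 : t ≤ 1 := min_le_right _ _
  have htθ : t ≤ θ := min_le_left _ _
  set b := t / (n + 1)
  have hb : 0 < b := by positivity
  have hbt : b * (n + 1) = t := by simp only [b]; field_simp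
  have hnb : n * b ^ 2 ≤ t ^ 2 := by
    rw [← hbt, mul_pow, mul_comm]
    gcongr
    nlinarith [(Nat.cast_nonneg n : (0 : ℝ) ≤ n)]
  have hnb1 : n * b ^ 2 ≤ 1 := hnb.trans (by nlinarith)
  have hb1 : |b| ≤ 1 := by
    rw [abs_of_pos hb]
    nlinarith [(Nat.cast_nonneg n : (0 : ℝ) ≤ n)]
  set a := √(1 - n * b ^ 2)
  have ha : a ^ 2 = 1 - n * b ^ 2 := Real.sq_sqrt (by linarith)
  have ha1 : |a| ≤ 1 := by
    rw [← sq_le_one_iff_abs_le_one, ha]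
    have : (0 : ℝ) ≤ n * b ^ 2 := by positivity
    linarith
  refine ⟨N, perturbedIndicator a b ω,
    orthonormal_perturbedIndicator hω hnN (by linarith), fun j => ?_, fun c d hc hd => ?_⟩
  · calc ∑ p : Fin n × Fin N with p.1 ≠ j, ‖perturbedIndicator a b ω j p‖ ^ 2
        = ∑ p : Fin n × Fin N with p.1 ≠ j, (N : ℝ)⁻¹ * b ^ 2 := by
          refine Finset.sum_congr rfl fun p hp => ?_
          rw [norm_perturbedIndicator_of_ne hω1 (Finset.mem_filter.mp hp).2, mul_pow, sq_abs,
            inv_pow, Real.sq_sqrt hNR.le]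
      _ ≤ ∑ _p : Fin n × Fin N, (N : ℝ)⁻¹ * b ^ 2 :=
          Finset.sum_le_sum_of_subset_of_nonneg (Finset.filter_subset _ _)
            fun _ _ _ => by positivity
      _ = n * b ^ 2 := by
          simp only [Finset.sum_const, Finset.card_univ, Fintype.card_prod, Fintype.card_fin,
            nsmul_eq_mul, Nat.cast_mul]
          field_simp
      _ ≤ θ ^ 2 := hnb.trans (by gcongr)
  · have hcoord : ∀ p : Fin n × Fin N,
        ‖∑ j, d j * perturbedIndicator a b ω j p‖ ≤ n * ((√(N : ℝ))⁻¹ * 2) := fun p =>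
      calc _ ≤ ∑ j, ‖d j * perturbedIndicator a b ω j p‖ := norm_sum_le _ _
        _ ≤ ∑ _j : Fin n, 1 * ((√(N : ℝ))⁻¹ * 2) := by
          refine Finset.sum_le_sum fun j _ => ?_
          rw [norm_mul]
          exact mul_le_mul (hd j) (norm_perturbedIndicator_le hω1 ha1 hb1 j p)
            (norm_nonneg _) zero_le_one
        _ = _ := by simp
    have hcard := card_zeros_perturbedIndicator_le (a := a) hω hN0 hb.ne' hc
    have hsqrt : 2 * n ^ 3 / τ ≤ √(N : ℝ) :=
      Real.le_sqrt_of_sq_le ((le_max_right _ _).trans hN.le)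
    have hspos : 0 < √(N : ℝ) := Real.sqrt_pos.mpr hNR
    calc _ ≤ _ := Finset.sum_le_card_nsmul _ _ _ fun p _ => hcoord p
      _ ≤ ((n * n : ℕ) : ℝ) * (n * ((√(N : ℝ))⁻¹ * 2)) := by
        rw [nsmul_eq_mul]
        gcongr
      _ = 2 * n ^ 3 / √(N : ℝ) := by push_cast; field_simp
      _ ≤ τ := by
        rw [div_le_iff₀ hspos]
        rwa [div_le_iff₀ hτ, mul_comm _ τ] at hsqrt

section Operators

variable {H : Type*} [NormedAddCommGroup H] [InnerProductSpace ℂ H] {ι : Type*} [Fintype ι]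

lemma Orthonormal.norm_sq_sum_smul {e : ι → H} (he : Orthonormal ℂ e) (c : ι → ℂ) :
    ‖∑ i, c i • e i‖ ^ 2 = ∑ i, ‖c i‖ ^ 2 := by
  have := he.inner_sum c c Finset.univ
  rw [inner_self_eq_norm_sq_to_K] at this
  have h : ((‖∑ i, c i • e i‖ ^ 2 : ℝ) : ℂ) = ((∑ i, ‖c i‖ ^ 2 : ℝ) : ℂ) := by
    push_cast
    refine this.trans (Finset.sum_congr rfl fun i _ => ?_)
    rw [Complex.conj_mul']
  exact_mod_cast h

/-- The finite rank operator that is diagonal in the family `e` with weights `μ`. -/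
def diagonalOperator (e : ι → H) (μ : ι → ℝ) : H →L[ℂ] H :=
  ∑ i, (μ i : ℂ) • (innerSL ℂ (e i)).smulRight (e i)

lemma diagonalOperator_apply (e : ι → H) (μ : ι → ℝ) (v : H) :
    diagonalOperator e μ v = ∑ i, (μ i * ⟪e i, v⟫_ℂ) • e i := by
  simp [diagonalOperator, mul_smul]

lemma diagonalOperator_sum_smul {e : ι → H} (he : Orthonormal ℂ e) (μ : ι → ℝ) (c : ι → ℂ) :
    diagonalOperator e μ (∑ i, c i • e i) = ∑ i, (μ i * c i) • e i := by
  rw [diagonalOperator_apply]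
  simp only [he.inner_right_fintype]

lemma diagonalOperator_pow_sum_smul {e : ι → H} (he : Orthonormal ℂ e) (μ : ι → ℝ) (c : ι → ℂ)
    (k : ℕ) :
    (diagonalOperator e μ ^ k) (∑ i, c i • e i) = ∑ i, ((μ i : ℂ) ^ k * c i) • e i := by
  induction k with
  | zero => simp
  | succ k ih =>
    rw [pow_succ', mul_apply_eq_comp, ih, diagonalOperator_sum_smul he]
    simp only [pow_succ', mul_assoc]

lemma diagonalOperator_mem_posUnitBall [CompleteSpace H] {e : ι → H} (he : Orthonormal ℂ e)
    {μ : ι → ℝ} (hμ : ∀ i, μ i ∈ Set.Icc (0 : ℝ) 1) : diagonalOperator e μ ∈ posUnitBall H := by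
  refine ⟨ContinuousLinearMap.isSelfAdjoint_iff_isSymmetric.mpr fun v w => ?_, fun v => ?_⟩
  · simp only [ContinuousLinearMap.coe_coe, diagonalOperator_apply, sum_inner, inner_sum,
      inner_smul_left, inner_smul_right, map_mul, Complex.conj_ofReal, inner_conj_symm]
    exact Finset.sum_congr rfl fun i _ => by ring
  · have h : ⟪diagonalOperator e μ v, v⟫_ℂ = ((∑ i, μ i * ‖⟪e i, v⟫_ℂ‖ ^ 2 : ℝ) : ℂ) := by
      simp only [diagonalOperator_apply, sum_inner, inner_smul_left, map_mul, Complex.conj_ofReal]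
      push_cast
      refine Finset.sum_congr rfl fun i _ => ?_
      rw [mul_assoc, Complex.conj_mul']
    rw [h]
    refine ⟨?_, ?_⟩
    · exact_mod_cast Finset.sum_nonneg fun i _ => mul_nonneg (hμ i).1 (sq_nonneg _)
    · rw [Complex.real_le_real]
      exact (Finset.sum_le_sum fun i _ => mul_le_of_le_one_left (sq_nonneg _) (hμ i).2).trans
        (he.sum_inner_products_le v)

/-- If the weights are distinct, the orbit of `∑ c i • e i` spans every `e i` with `c i ≠ 0`. -/
lemma mem_span_orbit_diagonalOperator {e : ι → H} (he : Orthonormal ℂ e) {μ : ι → ℝ}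
    (hμ : Function.Injective μ) (c : ι → ℂ) {i : ι} (hi : c i ≠ 0) :
    e i ∈ Submodule.span ℂ
      (Set.range fun k : ℕ => (diagonalOperator e μ ^ k) (∑ i, c i • e i)) := by
  classical
  set S := Submodule.span ℂ
      (Set.range fun k : ℕ => (diagonalOperator e μ ^ k) (∑ i, c i • e i))
  have hpoly : ∀ p : Polynomial ℂ, ∑ l, (p.eval (μ l : ℂ) * c l) • e l ∈ S := by
    intro p
    have : ∑ l, (p.eval (μ l : ℂ) * c l) • e l =
        ∑ k ∈ Finset.range (p.natDegree + 1),
          p.coeff k • (diagonalOperator e μ ^ k) (∑ i, c i • e i) := by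
      simp only [diagonalOperator_pow_sum_smul he, Finset.smul_sum, smul_smul]
      rw [Finset.sum_comm]
      refine Finset.sum_congr rfl fun l _ => ?_
      rw [← Finset.sum_smul, Polynomial.eval_eq_sum_range, Finset.sum_mul]
      simp only [mul_assoc]
    rw [this]
    exact S.sum_mem fun k _ => S.smul_mem _ (Submodule.subset_span ⟨k, rfl⟩)
  have hinj : Set.InjOn (fun l => (μ l : ℂ)) (Finset.univ : Finset ι) :=
    (Complex.ofReal_injective.comp hμ).injOn
  have := hpoly (Lagrange.basis Finset.univ (fun l => (μ l : ℂ)) i)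
  rw [Finset.sum_eq_single i] at this
  · rw [Lagrange.eval_basis_self hinj (Finset.mem_univ i), one_mul] at this
    exact (S.smul_mem_iff hi).mp this
  · intro l _ hl
    rw [Lagrange.eval_basis_of_ne (v := fun l => (μ l : ℂ)) (Ne.symm hl) (Finset.mem_univ l),
      zero_mul, zero_smul]
  · simp

lemma infDist_span_orbit_diagonalOperator_le {e : ι → H} (he : Orthonormal ℂ e) {μ : ι → ℝ}
    (hμ : Function.Injective μ) (c d : ι → ℂ) :
    Metric.infDist (∑ i, d i • e i) ((Submodule.span ℂ
      (Set.range fun k : ℕ => (diagonalOperator e μ ^ k) (∑ i, c i • e i)) : Submodule ℂ H) :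
        Set H) ≤ ∑ i with c i = 0, ‖d i‖ := by
  have hmem := Submodule.sum_mem (t := Finset.univ.filter fun i => c i ≠ 0)
    (f := fun i => d i • e i) _ fun i hi =>
      Submodule.smul_mem _ (d i)
        (mem_span_orbit_diagonalOperator he hμ c (Finset.mem_filter.mp hi).2)
  refine (Metric.infDist_le_dist_of_mem hmem).trans ?_
  rw [dist_eq_norm, ← Finset.sum_filter_add_sum_filter_not Finset.univ (fun i => c i = 0),
    add_sub_cancel_right]
  refine (norm_sum_le _ _).trans (Finset.sum_le_sum fun i _ => ?_)
  rw [norm_smul, he.1 i, mul_one]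

/-- Points of `[0, 1]` can be moved slightly inside `[0, 1]` so as to become distinct. -/
lemma exists_injective_near (l : ι → ℝ) (hl : ∀ i, l i ∈ Set.Icc (0 : ℝ) 1) {ε : ℝ}
    (hε : 0 < ε) :
    ∃ μ : ι → ℝ, Function.Injective μ ∧ ∀ i, μ i ∈ Set.Icc (0 : ℝ) 1 ∧ |μ i - l i| ≤ ε := by
  classical
  have hinf : ∀ i, {t | t ∈ Set.Icc (0 : ℝ) 1 ∧ |t - l i| ≤ ε}.Infinite := by
    intro i
    obtain ⟨h0, h1⟩ := hl i
    refine (Set.Icc_infinite (a := max 0 (l i - ε)) (b := min 1 (l i + ε)) ?_).mono ?_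
    · rw [max_lt_iff, lt_min_iff, lt_min_iff]
      refine ⟨⟨?_, ?_⟩, ?_, ?_⟩ <;> linarith
    · rintro t ⟨ht, ht'⟩
      rw [max_le_iff] at ht
      rw [le_min_iff] at ht'
      exact ⟨⟨ht.1, ht'.1⟩, abs_le.mpr ⟨by linarith, by linarith⟩⟩
  suffices ∀ s : Finset ι, ∃ μ : ι → ℝ, Set.InjOn μ s ∧
      ∀ i ∈ s, μ i ∈ Set.Icc (0 : ℝ) 1 ∧ |μ i - l i| ≤ ε by
    obtain ⟨μ, h1, h2⟩ := this Finset.univ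
    exact ⟨μ, by simpa [Set.injOn_univ] using h1, fun i => h2 i (Finset.mem_univ i)⟩
  intro s
  induction s using Finset.induction_on with
  | empty => exact ⟨l, by simp, by simp⟩
  | insert i s hi ih =>
    obtain ⟨μ, h1, h2⟩ := ih
    obtain ⟨t, ht, hts⟩ := (hinf i).exists_notMem_finset (s.image μ)
    have hagree : ∀ k ∈ s, Function.update μ i t k = μ k := fun k hk =>
      Function.update_of_ne (ne_of_mem_of_not_mem hk hi) _ _
    refine ⟨Function.update μ i t, ?_, ?_⟩
    · rw [Finset.coe_insert, Set.injOn_insert (by simpa using hi)]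
      refine ⟨h1.congr fun k hk => (hagree k hk).symm, ?_⟩
      rintro ⟨k, hk, hkt⟩
      rw [hagree k hk, Function.update_self] at hkt
      exact hts (hkt ▸ Finset.mem_image_of_mem μ hk)
    · intro k hk
      rcases Finset.mem_insert.mp hk with rfl | hk
      · simpa using ht
      · rw [hagree k hk]
        exact h2 k hk

end Operators

lemma exists_le_finrank_eq_add {K V : Type*} [Field K] [AddCommGroup V] [Module K V]
    (hV : ¬ FiniteDimensional K V) (S : Submodule K V) [FiniteDimensional K S] (m : ℕ) :
    ∃ W : Submodule K V, S ≤ W ∧ FiniteDimensional K W ∧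
      Module.finrank K W = Module.finrank K S + m := by
  induction m with
  | zero => exact ⟨S, le_rfl, inferInstance, rfl⟩
  | succ m ih =>
    obtain ⟨W, hSW, hW, hfr⟩ := ih
    have hne : W ≠ ⊤ := fun h => hV <| by
      subst h
      exact Module.Finite.equiv (Submodule.topEquiv (R := K) (M := V))
    obtain ⟨v, -, hv⟩ := SetLike.exists_of_lt hne.lt_top
    have hv0 : v ≠ 0 := fun h => hv (h ▸ W.zero_mem)
    refine ⟨W ⊔ K ∙ v, hSW.trans le_sup_left, inferInstance, ?_⟩
    have hinf : W ⊓ K ∙ v = ⊥ :=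
      disjoint_iff.mp ((Submodule.disjoint_span_singleton' hv0).mpr hv)
    have := Submodule.finrank_sup_add_finrank_inf_eq W (K ∙ v)
    rw [hinf, finrank_bot, finrank_span_singleton hv0, hfr] at this
    omega

lemma Orthonormal.exists_orthonormalBasis_comp_embedding {F κ ι : Type*} [NormedAddCommGroup F]
    [InnerProductSpace ℂ F] [FiniteDimensional ℂ F] [Fintype ι]
    (hcard : Module.finrank ℂ F = Fintype.card ι) {g : κ → F} (hg : Orthonormal ℂ g) (φ : κ ↪ ι) :
    ∃ b : OrthonormalBasis ι ℂ F, ∀ k, b (φ k) = g k := by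
  have hv : Orthonormal ℂ ((Set.range φ).domRestrict (Function.extend φ g 0)) := by
    convert hg.comp _ (Equiv.ofInjective φ φ.injective).symm.injective using 1
    ext ⟨_, k, rfl⟩
    simp [φ.injective.extend_apply, Equiv.ofInjective_symm_apply]
  obtain ⟨b, hb⟩ := hv.exists_orthonormalBasis_extension_of_card_eq hcard
  exact ⟨b, fun k => by rw [hb _ ⟨k, rfl⟩, φ.injective.extend_apply]⟩

section Hilbert

variable {H : Type*} [NormedAddCommGroup H] [InnerProductSpace ℂ H]

/-- In an infinite-dimensional space, an orthonormal family can be given any prescribed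
orthonormal coordinate vectors with respect to a suitable orthonormal family. -/
lemma exists_orthonormal_prescribed_coordinates (hinf : ¬ FiniteDimensional ℂ H)
    {κ ι : Type*} [Fintype κ] [Fintype ι] {f : κ → H} (hf : Orthonormal ℂ f)
    {g : κ → ι → ℂ} (hg : Orthonormal ℂ fun k => WithLp.toLp 2 (g k)) :
    ∃ e : ι → H, Orthonormal ℂ e ∧ ∀ k, f k = ∑ i, g k i • e i := by
  classical
  have hle : Fintype.card κ ≤ Fintype.card ι := by
    simpa using hg.linearIndependent.fintype_card_le_finrank
  obtain ⟨φ⟩ := Function.Embedding.nonempty_of_card_le hle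
  have : FiniteDimensional ℂ (Submodule.span ℂ (Set.range f)) :=
    FiniteDimensional.span_of_finite ℂ (Set.finite_range f)
  obtain ⟨W, hSW, hWfd, hW⟩ := exists_le_finrank_eq_add hinf
    (Submodule.span ℂ (Set.range f)) (Fintype.card ι - Fintype.card κ)
  rw [finrank_span_eq_card hf.linearIndependent, Nat.add_sub_cancel' hle] at hW
  let f' : κ → W := fun k => ⟨f k, hSW (Submodule.subset_span ⟨k, rfl⟩)⟩
  have hf' : Orthonormal ℂ f' := by
    rw [← W.subtypeₗᵢ.orthonormal_comp_iff]
    exact hf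
  obtain ⟨b, hb⟩ := hg.exists_orthonormalBasis_comp_embedding (by simp) φ
  obtain ⟨b', hb'⟩ := hf'.exists_orthonormalBasis_comp_embedding hW φ
  let V : EuclideanSpace ℂ ι →ₗᵢ[ℂ] H :=
    W.subtypeₗᵢ.comp (b.equiv b' (Equiv.refl ι)).toLinearIsometry
  have hV : ∀ k, V (WithLp.toLp 2 (g k)) = f k := fun k => by
    simp [V, ← hb, hb', f']
  refine ⟨fun i => V (EuclideanSpace.basisFun ι ℂ i),
    (EuclideanSpace.basisFun ι ℂ).orthonormal.comp_linearIsometry V, fun k => ?_⟩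
  rw [← hV, ← (EuclideanSpace.basisFun ι ℂ).sum_repr (WithLp.toLp 2 (g k)), map_sum]
  simp

/-- On a finite-dimensional subspace, an operator of `posUnitBall H` is diagonal in a finite
orthonormal family with weights in `[0, 1]`. -/
lemma exists_orthonormal_diagonal_on [CompleteSpace H] {A : H →L[ℂ] H} (hA : A ∈ posUnitBall H)
    (S : Submodule ℂ H) [FiniteDimensional ℂ S] :
    ∃ (n : ℕ) (f : Fin n → H) (l : Fin n → ℝ), Orthonormal ℂ f ∧
      (∀ j, l j ∈ Set.Icc (0 : ℝ) 1) ∧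
      ∀ h ∈ S, h = ∑ j, ⟪f j, h⟫_ℂ • f j ∧ A h = ∑ j, ⟪f j, h⟫_ℂ • (l j : ℂ) • f j := by
  set F : Submodule ℂ H := S ⊔ S.map (A : H →ₗ[ℂ] H)
  let T : F →ₗ[ℂ] F := (F.orthogonalProjectionOnto ∘L A ∘L F.subtypeL : F →L[ℂ] F)
  have hTapp : ∀ u : F, T u = F.orthogonalProjectionOnto (A u) := fun u => rfl
  have hTinner : ∀ u w : F, ⟪T u, w⟫_ℂ = ⟪A u, w⟫_ℂ := fun u w => by
    rw [hTapp, Submodule.inner_orthogonalProjectionOnto_eq_of_mem_right]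
  have hT : T.IsSymmetric := fun u w => by
    rw [hTinner, ← inner_conj_symm u (T w), hTinner, inner_conj_symm]
    exact (ContinuousLinearMap.isSelfAdjoint_iff_isSymmetric.mp hA.1) u w
  set b := hT.eigenvectorBasis rfl
  set l := hT.eigenvalues rfl
  have hTb : ∀ j, T (b j) = (l j : ℂ) • b j := hT.apply_eigenvectorBasis rfl
  have hexp : ∀ u : F, u = ∑ j, ⟪(b j : H), (u : H)⟫_ℂ • b j := fun u =>
    (b.sum_repr' u).symm
  refine ⟨_, fun j => (b j : H), l, b.orthonormal.comp_linearIsometry F.subtypeₗᵢ,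
    fun j => ?_, fun h hh => ?_⟩
  · have h1 : ⟪A (b j), (b j : H)⟫_ℂ = l j := by
      rw [← hTinner, hTb, inner_smul_left, inner_self_eq_norm_sq_to_K, b.orthonormal.1 j]
      simp
    have h2 := hA.2 (b j)
    have hn : ‖(b j : H)‖ = 1 := b.orthonormal.1 j
    rw [h1, hn] at h2
    exact ⟨by exact_mod_cast h2.1, by simpa using Complex.real_le_real.mp h2.2⟩
  · have hhF : h ∈ F := Submodule.mem_sup_left hh
    have hAhF : A h ∈ F := Submodule.mem_sup_right ⟨h, hh, rfl⟩
    have h1 := hexp ⟨h, hhF⟩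
    have h2 : A h = T ⟨h, hhF⟩ := by
      rw [hTapp]
      exact congrArg Subtype.val
        (Submodule.orthogonalProjectionOnto_mem_subspace_eq_self (⟨A h, hAhF⟩ : F)).symm
    refine ⟨by simpa using congrArg (Subtype.val) h1, ?_⟩
    rw [h2]
    conv_lhs => rw [h1]
    simp only [map_sum, map_smul, hTb]
    simp

/-- If `f` has mass at most `θ ^ 2` where the weights are far from `l`, it is nearly an eigenvector
of the diagonal operator. -/
lemma norm_diagonalOperator_sub_smul_le {ι : Type*} [Fintype ι] {e : ι → H} (he : Orthonormal ℂ e)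
    {μ : ι → ℝ} (hμ : ∀ i, μ i ∈ Set.Icc (0 : ℝ) 1) {l : ℝ} (hl : l ∈ Set.Icc (0 : ℝ) 1)
    {θ : ℝ} (hθ : 0 ≤ θ) {g : ι → ℂ} (hg : ∑ i, ‖g i‖ ^ 2 = 1) (q : ι → Prop) [DecidablePred q]
    (hnear : ∀ i, q i → |μ i - l| ≤ θ) (hfar : ∑ i with ¬ q i, ‖g i‖ ^ 2 ≤ θ ^ 2) :
    ‖diagonalOperator e μ (∑ i, g i • e i) - (l : ℂ) • ∑ i, g i • e i‖ ≤ 2 * θ := by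
  have hdiff : diagonalOperator e μ (∑ i, g i • e i) - (l : ℂ) • ∑ i, g i • e i =
      ∑ i, (((μ i - l : ℝ) : ℂ) * g i) • e i := by
    rw [diagonalOperator_sum_smul he, Finset.smul_sum, ← Finset.sum_sub_distrib]
    refine Finset.sum_congr rfl fun i _ => ?_
    rw [smul_smul, ← sub_smul, Complex.ofReal_sub, sub_mul]
  refine abs_le_of_sq_le_sq' ?_ (by positivity) |>.2
  rw [hdiff, he.norm_sq_sum_smul, ← Finset.sum_filter_add_sum_filter_not Finset.univ q]
  simp only [norm_mul, mul_pow, Complex.norm_real, Real.norm_eq_abs]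
  have h1 : ∑ i with q i, |μ i - l| ^ 2 * ‖g i‖ ^ 2 ≤ θ ^ 2 := by
    calc _ ≤ ∑ i with q i, θ ^ 2 * ‖g i‖ ^ 2 := Finset.sum_le_sum fun i hi => by
          gcongr
          exact hnear i (Finset.mem_filter.mp hi).2
      _ ≤ ∑ i, θ ^ 2 * ‖g i‖ ^ 2 :=
          Finset.sum_le_sum_of_subset_of_nonneg (Finset.filter_subset _ _)
            fun _ _ _ => by positivity
      _ = θ ^ 2 := by rw [← Finset.mul_sum, hg, mul_one]
  have h2 : ∑ i with ¬ q i, |μ i - l| ^ 2 * ‖g i‖ ^ 2 ≤ θ ^ 2 := by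
    refine (Finset.sum_le_sum fun i _ => ?_).trans hfar
    refine mul_le_of_le_one_left (sq_nonneg _) (pow_le_one₀ (abs_nonneg _) ?_)
    obtain ⟨h1, h2⟩ := hμ i
    exact abs_le.mpr ⟨by linarith [hl.2], by linarith [hl.1]⟩
  nlinarith [sq_nonneg θ]

/-- Approximation of an operator of `posUnitBall H` on finitely many vectors by operators for which
every nonzero vector of `E` is cyclic up to `δ` for `x`. -/
lemma exists_mem_posUnitBall_near [CompleteSpace H] (hinf : ¬ FiniteDimensional ℂ H)
    (E : Submodule ℂ H) [FiniteDimensional ℂ E] {x : H} (hx : ‖x‖ ≤ 1) {δ : ℝ} (hδ : 0 < δ)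
    {A : H →L[ℂ] H} (hA : A ∈ posUnitBall H) (s : Finset H) {ε : ℝ} (hε : 0 < ε) :
    ∃ B ∈ posUnitBall H, (∀ v ∈ E, v ≠ 0 →
        Metric.infDist x ((Submodule.span ℂ
          (Set.range fun k : ℕ => (B ^ k) v) : Submodule ℂ H) : Set H) < δ) ∧
      ∀ h ∈ s, ‖B h - A h‖ < ε := by
  have hspan : FiniteDimensional ℂ (Submodule.span ℂ (s : Set H)) :=
    FiniteDimensional.span_finset ℂ s
  obtain ⟨n, f, l, hf, hl, hdiag⟩ :=
    exists_orthonormal_diagonal_on hA (E ⊔ (ℂ ∙ x) ⊔ Submodule.span ℂ (s : Set H))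
  set R := ∑ h ∈ s, ‖h‖
  have hR : 0 ≤ R := Finset.sum_nonneg fun _ _ => norm_nonneg _
  set θ := ε / (2 * (n + 1) * (R + 1))
  have hθ : 0 < θ := by positivity
  have hθε : θ * (2 * (n + 1) * (R + 1)) = ε := by simp only [θ]; field_simp
  obtain ⟨N, g, hg, hfar, hzeros⟩ := exists_orthonormal_small_on_zeros n hθ (half_pos hδ)
  obtain ⟨e, he, hfe⟩ := exists_orthonormal_prescribed_coordinates hinf hf hg
  obtain ⟨μ, hμinj, hμ⟩ := exists_injective_near
    (fun p : Fin n × Fin N => l p.1) (fun p => hl p.1) hθ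
  have hcoord : ∀ c : Fin n → ℂ, ∑ j, c j • f j = ∑ p, (∑ j, c j * g j p) • e p := fun c => by
    simp only [hfe, Finset.smul_sum, smul_smul, Finset.sum_smul]
    exact Finset.sum_comm
  refine ⟨diagonalOperator e μ, diagonalOperator_mem_posUnitBall he fun p => (hμ p).1,
    fun v hv hv0 => ?_, fun h hh => ?_⟩
  · have hvexp := (hdiag v (Submodule.mem_sup_left (Submodule.mem_sup_left hv))).1
    have hxexp := (hdiag x (Submodule.mem_sup_left (Submodule.mem_sup_right
      (Submodule.mem_span_singleton_self x)))).1
    have hc : (fun j => ⟪f j, v⟫_ℂ) ≠ 0 := fun h0 => hv0 <| by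
      rw [hvexp]
      exact Finset.sum_eq_zero fun j _ => by rw [congrFun h0 j]; simp
    have hd : ∀ j, ‖⟪f j, x⟫_ℂ‖ ≤ 1 := fun j =>
      (norm_inner_le_norm _ _).trans (by rw [hf.1 j, one_mul]; exact hx)
    rw [hcoord] at hvexp hxexp
    have hle := infDist_span_orbit_diagonalOperator_le he hμinj
      (fun p => ∑ j, ⟪f j, v⟫_ℂ * g j p) (fun p => ∑ j, ⟪f j, x⟫_ℂ * g j p)
    rw [← hvexp, ← hxexp] at hle
    exact (hle.trans (hzeros _ _ hc hd)).trans_lt (half_lt_self hδ)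
  · obtain ⟨hexp, hAh⟩ := hdiag h (Submodule.mem_sup_right (Submodule.subset_span hh))
    have heig : ∀ j, ‖diagonalOperator e μ (f j) - (l j : ℂ) • f j‖ ≤ 2 * θ := fun j => by
      rw [hfe j]
      refine norm_diagonalOperator_sub_smul_le he (fun p => (hμ p).1) (hl j) hθ.le ?_
        (fun p => p.1 = j) (fun p hp => hp ▸ (hμ p).2) (hfar j)
      rw [← he.norm_sq_sum_smul, ← hfe, hf.1 j, one_pow]
    have hBA : diagonalOperator e μ h - A h =
        ∑ j, ⟪f j, h⟫_ℂ • (diagonalOperator e μ (f j) - (l j : ℂ) • f j) := by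
      simp only [smul_sub, Finset.sum_sub_distrib, ← hAh, ← map_smul]
      rw [← map_sum, ← hexp]
    have hhR : ‖h‖ ≤ R := Finset.single_le_sum (f := fun h => ‖h‖) (fun _ _ => norm_nonneg _) hh
    calc ‖diagonalOperator e μ h - A h‖
        ≤ ∑ j, ‖⟪f j, h⟫_ℂ • (diagonalOperator e μ (f j) - (l j : ℂ) • f j)‖ := by
          rw [hBA]
          exact norm_sum_le _ _
      _ ≤ ∑ _j : Fin n, R * (2 * θ) := Finset.sum_le_sum fun j _ => by
          rw [norm_smul]
          refine mul_le_mul ?_ (heig j) (norm_nonneg _) hR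
          exact (norm_inner_le_norm _ _).trans (by rw [hf.1 j, one_mul]; exact hhR)
      _ = θ * (2 * n * R) := by simp; ring
      _ < θ * (2 * (n + 1) * (R + 1)) := by
          gcongr ?_ * ?_
          nlinarith [(Nat.cast_nonneg n : (0 : ℝ) ≤ n)]
      _ = ε := hθε

end Hilbert

/-- Let `H` be a separable, infinite-dimensional complex Hilbert space, `E` a
finite-dimensional subspace of `H`, `x ∈ H` with `‖x‖ ≤ 1`, and `δ > 0`.  Then the set of
operators `A` in the positive part of the closed unit ball of `B(H)` such that
`dist(x, span {Aᵏ v : k ∈ ℕ}) < δ` for every nonzero `v ∈ E` is dense for the relative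
strong operator topology. -/
theorem dense_good_set (H : Type*) [NormedAddCommGroup H]
    [InnerProductSpace ℂ H] [CompleteSpace H] [TopologicalSpace.SeparableSpace H]
    (hinf : ¬ FiniteDimensional ℂ H) (E : Submodule ℂ H) [FiniteDimensional ℂ E]
    (x : H) (hx : ‖x‖ ≤ 1) (δ : ℝ) (hδ : 0 < δ) :
    @Dense (posUnitBall H) (sot H)
      {A | ∀ v ∈ E, v ≠ 0 →
        Metric.infDist x ((Submodule.span ℂ
          (Set.range fun k : ℕ => ((A : H →L[ℂ] H) ^ k) v) : Submodule ℂ H) : Set H) < δ} := by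
  intro A
  let _ : TopologicalSpace (posUnitBall H) := sot H
  rw [mem_closure_iff]
  rintro _ ⟨O, hO, rfl⟩ hAO
  obtain ⟨s, u, hu, hsub⟩ := isOpen_pi_iff.mp hO _ hAO
  have hball : ∀ h ∈ s, ∃ ε > 0, Metric.ball ((A : H →L[ℂ] H) h) ε ⊆ u h := fun h hh =>
    Metric.isOpen_iff.mp (hu h hh).1 _ (hu h hh).2
  choose! r hr hru using hball
  obtain ⟨ε, hε, hεr⟩ : ∃ ε > 0, ∀ h ∈ s, ε ≤ r h := by
    rcases s.eq_empty_or_nonempty with rfl | hs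
    · exact ⟨1, one_pos, by simp⟩
    · obtain ⟨h₀, hh₀, hmin⟩ := s.exists_min_image r hs
      exact ⟨r h₀, hr h₀ hh₀, hmin⟩
  obtain ⟨B, hB, hgood, hnear⟩ := exists_mem_posUnitBall_near hinf E hx hδ A.2 s hε
  refine ⟨⟨B, hB⟩, hsub fun h hh => hru h hh ?_, hgood⟩
  rw [Metric.mem_ball, dist_eq_norm]
  exact (hnear h hh).trans_le (hεr h hh)
end
end

section
/- Let H be a complex Hilbert space, let A ∈ B(H), let E be a nonzero finite-dimensional subspace of H, let x ∈ H, and let δ > 0. Suppose that dist(x, closure of span{Aᵏv : k ∈ ℕ}) < δ for every nonzero v ∈ E. Then there exist N ∈ ℕ and δ′ < δ such that dist(x, span{Aᵏv : 0 ≤ k ≤ N}) ≤ δ′ for every unit vector v ∈ E. -/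
/-- Let `H` be a complex Hilbert space, `A ∈ B(H)`, `E` a nonzero finite-dimensional
subspace, `x ∈ H` and `δ > 0`.  If `dist(x, closure (span {Aᵏ v : k ∈ ℕ})) < δ` for every
nonzero `v ∈ E`, then there are `N ∈ ℕ` and `δ' < δ` with
`dist(x, span {Aᵏ v : 0 ≤ k ≤ N}) ≤ δ'` for every unit vector `v ∈ E`. -/
theorem uniform_truncation (H : Type*) [NormedAddCommGroup H]
    [InnerProductSpace ℂ H] [CompleteSpace H] (A : H →L[ℂ] H)
    (E : Submodule ℂ H) [FiniteDimensional ℂ E] (hE : E ≠ ⊥)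
    (x : H) (δ : ℝ) (hδ : 0 < δ)
    (h : ∀ v ∈ E, v ≠ 0 →
      Metric.infDist x
        (closure ((Submodule.span ℂ
          (Set.range fun k : ℕ => (A ^ k) v) : Submodule ℂ H) : Set H)) < δ) :
    ∃ (N : ℕ) (δ' : ℝ), δ' < δ ∧ ∀ v ∈ E, ‖v‖ = 1 →
      Metric.infDist x
        ((Submodule.span ℂ ((fun k : ℕ => (A ^ k) v) '' Set.Iic N) : Submodule ℂ H) : Set H)
        ≤ δ' := by
  have : ProperSpace E := FiniteDimensional.proper ℂ E
  suffices hs : ∃ (N : ℕ) (δ' : ℝ), δ' < δ ∧ ∀ v ∈ Metric.sphere (0 : E) 1,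
      Metric.infDist x ((Submodule.span ℂ ((fun k : ℕ => (A ^ k) (v : H)) '' Set.Iic N) :
        Submodule ℂ H) : Set H) ≤ δ' by
    obtain ⟨N, δ', hlt, hN⟩ := hs
    exact ⟨N, δ', hlt, fun v hv hv1 => hN ⟨v, hv⟩ (by simpa using hv1)⟩
  have hanti : ∀ (v : H) {M N : ℕ}, M ≤ N →
      Metric.infDist x ((Submodule.span ℂ ((fun k : ℕ => (A ^ k) v) '' Set.Iic N) :
        Submodule ℂ H) : Set H) ≤
      Metric.infDist x ((Submodule.span ℂ ((fun k : ℕ => (A ^ k) v) '' Set.Iic M) :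
        Submodule ℂ H) : Set H) := fun v M N hMN =>
    Metric.infDist_le_infDist_of_subset
      (Submodule.span_mono (Set.image_mono (Set.Iic_subset_Iic.2 hMN))) ⟨0, Submodule.zero_mem _⟩
  refine (isCompact_sphere (0 : E) 1).induction_on ⟨0, δ - 1, by linarith, by simp⟩ ?_ ?_ ?_
  · rintro s t hst ⟨N, δ', hlt, hN⟩
    exact ⟨N, δ', hlt, fun v hv => hN v (hst hv)⟩
  · rintro s t ⟨N, δ₁, hlt₁, hN⟩ ⟨M, δ₂, hlt₂, hM⟩
    refine ⟨max N M, max δ₁ δ₂, max_lt hlt₁ hlt₂, ?_⟩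
    rintro v (hv | hv)
    · exact ((hanti _ (le_max_left _ _)).trans (hN v hv)).trans (le_max_left _ _)
    · exact ((hanti _ (le_max_right _ _)).trans (hM v hv)).trans (le_max_right _ _)
  · intro v hv
    have hv0 : (v : H) ≠ 0 := by
      intro h0
      have hv1 : ‖(v : H)‖ = 1 := by simpa using hv
      simp [h0] at hv1
    have hlt := h v v.2 hv0
    rw [Metric.infDist_closure, Metric.infDist_lt_iff ⟨0, Submodule.zero_mem _⟩] at hlt
    obtain ⟨y, hy, hxy⟩ := hlt
    obtain ⟨c, rfl⟩ := Finsupp.mem_span_range_iff_exists_finsupp.1 hy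
    obtain ⟨δ', h1, h2⟩ := exists_between hxy
    have hcont : Continuous fun w : E => dist x (c.sum fun i a => a • (A ^ i) (w : H)) := by
      unfold Finsupp.sum
      fun_prop
    refine ⟨{w | dist x (c.sum fun i a => a • (A ^ i) (w : H)) < δ'},
      mem_nhdsWithin_of_mem_nhds ((isOpen_lt hcont continuous_const).mem_nhds h1),
      c.support.sup id, δ', h2, fun w hw => ?_⟩
    refine (Metric.infDist_le_dist_of_mem ?_).trans (le_of_lt hw)
    exact Submodule.sum_mem _ fun i hi => Submodule.smul_mem _ _
      (Submodule.subset_span ⟨i, Finset.le_sup (f := id) hi, rfl⟩)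
end

section
/- Let X be a finite-dimensional complex inner product space of dimension d, let (e₁, ..., e_d) be an orthonormal basis of X, let σ₁, ..., σ_d be pairwise distinct complex scalars, and let B : X → X be the linear map with Be_i = σ_i e_i for all i. Then for every v ∈ X, the linear span of {Bᵏv : k ∈ ℕ} (with B⁰ = identity) equals the linear span of {e_i : ⟨v, e_i⟩ ≠ 0}. -/
open scoped InnerProductSpace

open Polynomial in
/-- The value of a polynomial in `f` at `x` lies in the span of the `f`-orbit of `x`. -/
lemma aeval_apply_mem_span_orbit {R M : Type*} [CommRing R] [AddCommGroup M] [Module R M]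
    (f : M →ₗ[R] M) (x : M) (p : R[X]) :
    aeval f p x ∈ Submodule.span R (Set.range fun k : ℕ => (f ^ k) x) := by
  rw [aeval_eq_sum_range, LinearMap.sum_apply]
  exact Submodule.sum_mem _ fun k _ =>
    Submodule.smul_mem _ _ (Submodule.subset_span ⟨k, rfl⟩)

open Polynomial in
/-- A polynomial in a map that is diagonal in an orthonormal basis acts diagonally. -/
lemma OrthonormalBasis.aeval_apply_eq_sum {ι E : Type*} [Fintype ι] [NormedAddCommGroup E]
    [InnerProductSpace ℂ E] (e : OrthonormalBasis ι ℂ E) {σ : ι → ℂ} {f : E →ₗ[ℂ] E}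
    (hf : ∀ i, f (e i) = σ i • e i) (p : ℂ[X]) (x : E) :
    aeval f p x = ∑ i, (⟪e i, x⟫_ℂ * p.eval (σ i)) • e i := by
  conv_lhs => rw [← e.sum_repr' x]
  simp [mul_smul, Module.End.aeval_apply_of_mem_apply_eq_smul (hf _)]

/-- Let `X` be a `d`-dimensional complex inner product space, `(e₁, …, e_d)` an
orthonormal basis of `X`, `σ₁, …, σ_d` pairwise distinct scalars, and `B` the linear map
with `B eᵢ = σᵢ eᵢ`.  Then for every `v`, the span of the orbit `{Bᵏ v : k ∈ ℕ}` equals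
the span of `{eᵢ : ⟪v, eᵢ⟫ ≠ 0}`. -/
theorem orbit_span_of_distinct_eigenvalues (X : Type*) [NormedAddCommGroup X]
    [InnerProductSpace ℂ X] [FiniteDimensional ℂ X] (d : ℕ)
    (hd : Module.finrank ℂ X = d) (e : OrthonormalBasis (Fin d) ℂ X)
    (σ : Fin d → ℂ) (hσ : Function.Injective σ)
    (B : X →ₗ[ℂ] X) (hB : ∀ i, B (e i) = σ i • e i) (v : X) :
    Submodule.span ℂ (Set.range fun k : ℕ => (B ^ k) v) =
      Submodule.span ℂ (⇑e '' {i | ⟪v, e i⟫_ℂ ≠ 0}) := by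
  apply le_antisymm
  · rw [Submodule.span_le]
    rintro _ ⟨k, rfl⟩
    have h := e.aeval_apply_eq_sum hB (Polynomial.X ^ k) v
    simp only [map_pow, Polynomial.aeval_X] at h
    simp only [h, SetLike.mem_coe]
    refine Submodule.sum_mem _ fun i _ => ?_
    by_cases hi : ⟪v, e i⟫_ℂ = 0
    · simp [inner_eq_zero_symm.mp hi]
    · exact Submodule.smul_mem _ _ (Submodule.subset_span ⟨i, hi, rfl⟩)
  · rw [Submodule.span_le]
    rintro _ ⟨i, hi, rfl⟩
    have h := e.aeval_apply_eq_sum hB (Lagrange.basis Finset.univ σ i) v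
    rw [Finset.sum_eq_single i
      (fun j _ hj => by simp [Lagrange.eval_basis_of_ne hj.symm (Finset.mem_univ j)])
      (by simp), Lagrange.eval_basis_self hσ.injOn (Finset.mem_univ i), mul_one] at h
    have hmem := aeval_apply_mem_span_orbit B v (Lagrange.basis Finset.univ σ i)
    rw [h] at hmem
    exact (Submodule.smul_mem_iff _ (mt inner_eq_zero_symm.mp hi)).mp hmem
end

section
/- Let P be the set of pairs (E, T), where E is a finite-dimensional subspace of the complex Hilbert space ℓ² = ℓ²(ℕ), T : E → ℓ² is a linear map with operator norm ‖T‖ < 1, and the only subspace E′ ⊆ E with T(E′) ⊆ E′ is E′ = {0}; order P by reverse inclusion, i.e. (E, T) ≤ (F, S) iff F ⊆ E and T restricted to F equals S. For unit vectors v, w ∈ ℓ², let D_{v,w} be the set of (E, T) ∈ P such that there exists n ≥ 1 with v ∈ E, Tv ∈ E, ..., Tⁿ⁻¹v ∈ E and ⟨Tⁿv, w⟩ ≠ 0. Then for all unit vectors v, w ∈ ℓ², the set D_{v,w} is dense in P: for every p ∈ P there exists q ∈ D_{v,w} with q ≤ p. -/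
open scoped InnerProductSpace

noncomputable section

/-- The complex Hilbert space `ℓ² = ℓ²(ℕ)`. -/
abbrev l2 : Type := lp (fun _ : ℕ => ℂ) 2

/-- The poset `P` of partially defined operators on `ℓ²`: pairs `(E, T)` where `E` is a
finite-dimensional subspace of `ℓ²`, `T : E → ℓ²` is linear with `‖T‖ < 1`, and the only
subspace `E' ⊆ E` with `T(E') ⊆ E'` is `{0}`. -/
structure PartialOp where
  /-- the (finite-dimensional) domain -/
  dom : Submodule ℂ l2
  findim : FiniteDimensional ℂ dom
  /-- the operator, defined on the domain -/
  toFun : dom →L[ℂ] l2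
  norm_lt : ‖toFun‖ < 1
  no_invariant : ∀ E' : Submodule ℂ dom,
    (∀ x ∈ E', toFun x ∈ E'.map dom.subtype) → E' = ⊥

/-- The order on `P`: reverse inclusion of partial operators, i.e. `(E, T) ≤ (F, S)` iff
`F ⊆ E` and `T` restricted to `F` equals `S`. -/
def PartialOp.le (p q : PartialOp) : Prop :=
  q.dom ≤ p.dom ∧
    ∀ (x : l2) (hq : x ∈ q.dom) (hp : x ∈ p.dom), p.toFun ⟨x, hp⟩ = q.toFun ⟨x, hq⟩

/-- For unit vectors `v, w ∈ ℓ²`, the set `D_{v,w}` of `(E, T) ∈ P` such that for some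
`n ≥ 1` the iterates `v, Tv, …, Tⁿ⁻¹v` all lie in `E` and `⟪Tⁿ v, w⟫ ≠ 0`. -/
def Dvw (v w : l2) : Set PartialOp :=
  {p | ∃ n : ℕ, 1 ≤ n ∧ ∃ u : ℕ → l2, u 0 = v ∧
    (∀ k < n, ∃ h : u k ∈ p.dom, u (k + 1) = p.toFun ⟨u k, h⟩) ∧ ⟪u n, w⟫_ℂ ≠ 0}

theorem l2_not_finiteDimensional : ¬ FiniteDimensional ℂ l2 := by
  intro h
  have hli : LinearIndependent ℂ (HilbertBasis.ofRepr (LinearIsometryEquiv.refl ℂ l2) : ℕ → l2) :=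
    (HilbertBasis.ofRepr (LinearIsometryEquiv.refl ℂ l2)).orthonormal.linearIndependent
  exact not_finite_iff_infinite.2 (inferInstanceAs (Infinite ℕ)) hli.finite

/-- Outside a finite-dimensional subspace of `ℓ²` there are arbitrarily small vectors whose inner
product with a given unit vector `w` avoids a prescribed value. -/
theorem exists_small_notMem_inner_ne (F : Submodule ℂ l2) [FiniteDimensional ℂ F] {w : l2}
    (hw : ‖w‖ = 1) (a : ℂ) {ε : ℝ} (hε : 0 < ε) :
    ∃ z : l2, z ∉ F ∧ ‖z‖ < ε ∧ ⟪z, w⟫_ℂ ≠ a := by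
  have hne : F ⊔ ℂ ∙ w ≠ ⊤ := by
    intro h
    apply l2_not_finiteDimensional
    have : FiniteDimensional ℂ (⊤ : Submodule ℂ l2) := h ▸ inferInstance
    exact Module.finite_def.2 ((Submodule.fg_top _).1 (Module.finite_def.1 this))
  obtain ⟨g, -, hg⟩ := SetLike.exists_of_lt hne.lt_top
  have hww : ⟪w, w⟫_ℂ = 1 := by rw [inner_self_eq_norm_sq_to_K, hw]; simp
  obtain ⟨g, hgF, hgw⟩ : ∃ g : l2, g ∉ F ∧ ⟪g, w⟫_ℂ ≠ 0 := by
    have hF : F ≤ F ⊔ ℂ ∙ w := le_sup_left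
    by_cases h : ⟪g, w⟫_ℂ = 0
    · refine ⟨g + w, fun hm => hg ?_, by rw [inner_add_left, h, hww]; simp⟩
      have hwm : w ∈ F ⊔ ℂ ∙ w :=
        (le_sup_right : ℂ ∙ w ≤ F ⊔ ℂ ∙ w) (Submodule.mem_span_singleton_self w)
      simpa using sub_mem (hF hm) hwm
    · exact ⟨g, fun hm => hg (hF hm), h⟩
  have hsmall : ∀ t : ℝ, 0 < t → t * ‖g‖ < ε → ⟪(t : ℂ) • g, w⟫_ℂ ≠ a →
      ∃ z : l2, z ∉ F ∧ ‖z‖ < ε ∧ ⟪z, w⟫_ℂ ≠ a := by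
    intro t ht hlt hne
    refine ⟨(t : ℂ) • g, fun hm => hgF ?_, ?_, hne⟩
    · exact (Submodule.smul_mem_iff F (Complex.ofReal_ne_zero.2 ht.ne')).1 hm
    · rw [norm_smul, Complex.norm_real, Real.norm_of_nonneg ht.le]
      exact hlt
  have hpos : 0 < ‖g‖ + 1 := by positivity
  set t := ε / (‖g‖ + 1)
  have ht : 0 < t := by positivity
  have hlt : t * ‖g‖ < ε := by
    have : t * (‖g‖ + 1) = ε := div_mul_cancel₀ _ hpos.ne'
    nlinarith
  by_cases h : ⟪(t : ℂ) • g, w⟫_ℂ = a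
  · refine hsmall (t / 2) (by positivity) (by nlinarith [norm_nonneg g]) fun h' => ?_
    rw [← h, inner_smul_left, inner_smul_left] at h'
    have := mul_right_cancel₀ hgw h'
    simp only [Complex.conj_ofReal, Complex.ofReal_inj] at this
    linarith
  · exact hsmall t ht hlt h

namespace PartialOp

variable (p : PartialOp)

instance : FiniteDimensional ℂ p.dom := p.findim

/-- The extension by zero of a partial operator to the orthogonal complement of its domain. -/
def extend : l2 →L[ℂ] l2 := p.toFun ∘L p.dom.orthogonalProjectionOnto

theorem extend_apply_of_mem {x : l2} (hx : x ∈ p.dom) : p.extend x = p.toFun ⟨x, hx⟩ := by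
  have : p.dom.orthogonalProjectionOnto x = ⟨x, hx⟩ :=
    p.dom.orthogonalProjectionOnto_mem_subspace_eq_self ⟨x, hx⟩
  simp [extend, this]

theorem norm_extend_lt : ‖p.extend‖ < 1 := by
  refine lt_of_le_of_lt ?_ p.norm_lt
  refine (ContinuousLinearMap.opNorm_comp_le _ _).trans ?_
  exact mul_le_of_le_one_right (ContinuousLinearMap.opNorm_nonneg _) p.dom.orthogonalProjectionOnto_norm_le

theorem eq_bot_of_extend_invariant {W : Submodule ℂ l2} (hW : W ≤ p.dom)
    (hinv : ∀ x ∈ W, p.extend x ∈ W) : W = ⊥ := by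
  have h := p.no_invariant (W.comap p.dom.subtype) fun x hx => by
    have hx' := hinv x hx
    rw [p.extend_apply_of_mem x.2] at hx'
    exact ⟨⟨p.toFun x, hW hx'⟩, hx', rfl⟩
  rw [eq_bot_iff]
  intro x hx
  have : (⟨x, hW hx⟩ : p.dom) ∈ W.comap p.dom.subtype := hx
  rw [h, Submodule.mem_bot] at this
  simpa using this

theorem exists_iterate_notMem {v : l2} (hv : v ≠ 0) : ∃ k, p.extend^[k] v ∉ p.dom := by
  by_contra! h
  have hspan : Submodule.span ℂ (Set.range fun k => p.extend^[k] v) = ⊥ := by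
    apply p.eq_bot_of_extend_invariant
    · rw [Submodule.span_le]
      rintro _ ⟨k, rfl⟩
      exact h k
    · intro x hx
      refine (Submodule.span_le (p := Submodule.comap (p.extend : l2 →ₗ[ℂ] l2)
        (Submodule.span ℂ (Set.range fun k => p.extend^[k] v)))).2 ?_ hx
      rintro _ ⟨k, rfl⟩
      exact Submodule.subset_span ⟨k + 1, Function.iterate_succ_apply' _ _ _⟩
  have : v ∈ Submodule.span ℂ (Set.range fun k => p.extend^[k] v) :=
    Submodule.subset_span ⟨0, rfl⟩
  rw [hspan] at this
  exact hv (by simpa using this)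

/-- A partial operator extends to any further vector `x`, with a prescribed unit vector not
orthogonal to the image of `x`. -/
theorem exists_le_inner_ne_zero {x w : l2} (hx : x ∉ p.dom) (hw : ‖w‖ = 1) :
    ∃ q : PartialOp, q.le p ∧ ∃ h : x ∈ q.dom, ⟪q.toFun ⟨x, h⟩, w⟫_ℂ ≠ 0 := by
  set y : l2 := x - p.dom.orthogonalProjectionOnto x with hy_def
  have hy : ∀ e ∈ p.dom, ⟪y, e⟫_ℂ = 0 := fun e he =>
    p.dom.starProjection_inner_eq_zero x e he
  have hy0 : y ≠ 0 := fun h => hx (by rw [sub_eq_zero.1 h]; exact Submodule.coe_mem _)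
  have hyx : ⟪y, x⟫_ℂ ≠ 0 := by
    have : ⟪y, x⟫_ℂ = ⟪y, y⟫_ℂ := by
      conv_rhs => rw [hy_def, inner_sub_right, ← hy_def]
      rw [hy _ (Submodule.coe_mem _), sub_zero]
    rw [this]
    exact inner_self_ne_zero.2 hy0
  set D : Submodule ℂ l2 := p.dom ⊔ ℂ ∙ x
  have hpD : p.dom ≤ D := le_sup_left
  have hxD : x ∈ D := (le_sup_right : ℂ ∙ x ≤ D) (Submodule.mem_span_singleton_self x)
  set F : Submodule ℂ l2 := D ⊔ LinearMap.range (p.toFun : p.dom →ₗ[ℂ] l2)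
  obtain ⟨z, hzF, hz, hzw⟩ := exists_small_notMem_inner_ne F hw
    (-⟪p.extend x, w⟫_ℂ / (starRingEnd ℂ) ⟪y, x⟫_ℂ)
    (div_pos (sub_pos.2 p.norm_extend_lt) (norm_pos_iff.2 hy0))
  set A : l2 →L[ℂ] l2 := p.extend + (innerSL ℂ y).smulRight z with hA_def
  have hA : ∀ u, A u = p.extend u + ⟪y, u⟫_ℂ • z := fun u => by simp [hA_def]
  have hAp : ∀ u ∈ p.dom, A u = p.extend u := fun u hu => by simp [hA, hy u hu]
  have hnorm : ‖A‖ < 1 := by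
    refine (norm_add_le _ _).trans_lt ?_
    rw [ContinuousLinearMap.norm_smulRight_apply, innerSL_apply_norm]
    rw [lt_div_iff₀ (norm_pos_iff.2 hy0)] at hz
    linarith
  have hmem : ∀ u ∈ D, A u ∈ D → u ∈ p.dom := by
    intro u hu hAu
    have hran : p.extend u ∈ F :=
      (le_sup_right : _ ≤ F) ⟨p.dom.orthogonalProjectionOnto u, rfl⟩
    have hzu : ⟪y, u⟫_ℂ • z ∈ F := by
      have := sub_mem ((le_sup_left : D ≤ F) hAu) hran
      rwa [hA, add_sub_cancel_left] at this
    have hyu : ⟪y, u⟫_ℂ = 0 := by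
      by_contra h
      exact hzF ((Submodule.smul_mem_iff F h).1 hzu)
    obtain ⟨e, he, f, hf, rfl⟩ := Submodule.mem_sup.1 hu
    obtain ⟨c, rfl⟩ := Submodule.mem_span_singleton.1 hf
    rw [inner_add_right, hy e he, zero_add, inner_smul_right] at hyu
    rw [(mul_eq_zero.1 hyu).resolve_right hyx]
    simpa using he
  refine ⟨⟨D, inferInstance, A ∘L D.subtypeL, ?_, ?_⟩, ⟨hpD, fun u hu _ => ?_⟩, hxD, ?_⟩
  · refine lt_of_le_of_lt ?_ hnorm
    refine (ContinuousLinearMap.opNorm_comp_le _ _).trans ?_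
    exact mul_le_of_le_one_right (ContinuousLinearMap.opNorm_nonneg _) D.norm_subtypeL_le
  · intro E' hE'
    have hsub : ∀ u ∈ E', (u : l2) ∈ p.dom := fun u hu => by
      refine hmem u u.2 ?_
      obtain ⟨u', -, hu'⟩ := hE' u hu
      exact (show A u = u' from hu'.symm) ▸ u'.2
    have hbot : E'.map D.subtype = ⊥ := by
      apply p.eq_bot_of_extend_invariant
      · rintro _ ⟨u, hu, rfl⟩
        exact hsub u hu
      · rintro _ ⟨u, hu, rfl⟩
        have := hE' u hu
        change A u ∈ _ at this
        rwa [hAp _ (hsub u hu)] at this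
    exact Submodule.map_injective_of_injective D.injective_subtype
      (hbot.trans (Submodule.map_bot _).symm)
  · change A u = _
    rw [hAp u hu, p.extend_apply_of_mem hu]
  · change ⟪A x, w⟫_ℂ ≠ 0
    rw [hA, inner_add_left, inner_smul_left]
    intro h
    apply hzw
    rw [eq_div_iff ((map_ne_zero _).2 hyx)]
    linear_combination h

end PartialOp

/-- For all unit vectors `v, w ∈ ℓ²`, the set `D_{v,w}` is dense in the poset `P`:
every `p ∈ P` has an extension `q ≤ p` lying in `D_{v,w}`. -/
theorem Dvw_dense (v w : l2) (hv : ‖v‖ = 1) (hw : ‖w‖ = 1) (p : PartialOp) :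
    ∃ q ∈ Dvw v w, PartialOp.le q p := by
  have hv0 : v ≠ 0 := by
    rintro rfl
    simp at hv
  have hex := p.exists_iterate_notMem hv0
  classical
  obtain ⟨k, hk, hlt⟩ : ∃ k, p.extend^[k] v ∉ p.dom ∧ ∀ i < k, p.extend^[i] v ∈ p.dom :=
    ⟨Nat.find hex, Nat.find_spec hex, fun i hi => not_not.1 (Nat.find_min hex hi)⟩
  obtain ⟨q, hqp, hx, hq⟩ := p.exists_le_inner_ne_zero hk hw
  have hext : ∀ u ∈ p.dom, q.extend u = p.extend u := fun u hu => by
    rw [q.extend_apply_of_mem (hqp.1 hu), p.extend_apply_of_mem hu, hqp.2 u hu]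
  have hiter : ∀ i ≤ k, q.extend^[i] v = p.extend^[i] v := by
    intro i
    induction i with
    | zero => simp
    | succ i ih =>
      intro hi
      rw [Function.iterate_succ_apply', Function.iterate_succ_apply', ih (by omega),
        hext _ (hlt i (by omega))]
  have hmem : ∀ i ≤ k, q.extend^[i] v ∈ q.dom := by
    intro i hi
    rw [hiter i hi]
    rcases hi.lt_or_eq with h | rfl
    · exact hqp.1 (hlt i h)
    · exact hx
  refine ⟨q, ⟨k + 1, by omega, fun i => q.extend^[i] v, rfl, fun i hi => ?_, ?_⟩, hqp⟩
  · have hi' := hmem i (by omega)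
    exact ⟨hi', by beta_reduce; rw [Function.iterate_succ_apply', q.extend_apply_of_mem hi']⟩
  · beta_reduce
    rw [Function.iterate_succ_apply', hiter k le_rfl, q.extend_apply_of_mem hx]
    exact hq
end
end
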